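/- arXiv:math/0605642 — 2 statements merged into one kernel-verified Lean document; each statement's English description precedes it below -/
import Mathlib

section
/- Let λ_n be positive reals with λ_n → λ for some λ > 0. For each n, let N_1,…,N_n be i.i.d. Poisson(λ_n) random variables, and set X_n := #{1 ≤ k ≤ n : N_k = 0} and Y_n := Σ_{k=1}^n N_k. Then n^{-1/2}(X_n − n e^{−λ_n}, Y_n − n λ_n) converges in distribution to a centered bivariate Gaussian vector (X, Y) with Var(X) = e^{−λ}(1 − e^{−λ}), Var(Y) = λ and Cov(X, Y) = −λ e^{−λ}. -/
open MeasureTheory ProbabilityTheory Filter Topology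

noncomputable section

/-- Convergence in distribution (weak convergence of laws): integrals of every bounded
continuous function converge. -/
def TendstoInDistribution {E : Type*} [MeasurableSpace E] [TopologicalSpace E]
    (μs : ℕ → Measure E) (μ : Measure E) : Prop :=
  ∀ f : BoundedContinuousFunction E ℝ,
    Tendsto (fun n => ∫ x, f x ∂(μs n)) atTop (𝓝 (∫ x, f x ∂μ))

/-- `κ` is a version of the conditional distribution of the first coordinate given the
second coordinate, for the joint law `μ`: it is a Markov kernel which disintegrates `μ`. -/
def IsCondLaw {E F : Type*} [MeasurableSpace E] [MeasurableSpace F]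
    (μ : Measure (E × F)) (κ : Kernel F E) : Prop :=
  IsMarkovKernel κ ∧
  ∀ s : Set E, ∀ t : Set F, MeasurableSet s → MeasurableSet t →
    μ (s ×ˢ t) = ∫⁻ z in t, κ z s ∂(μ.map Prod.snd)

/-- A family of measures `κ z` (conditional distributions) is stochastically increasing:
`P(X ≤ x | Y = z)` is weakly decreasing in `z`. -/
def StochIncrFam {E F : Type*} [MeasurableSpace E] [Preorder E] [Preorder F]
    (κ : F → Measure E) : Prop :=
  ∀ z₁ z₂ : F, z₁ ≤ z₂ → ∀ x : E, κ z₂ {w | w ≤ x} ≤ κ z₁ {w | w ≤ x}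

/-- A family of measures `κ z` is stochastically decreasing: `P(X ≥ x | Y = z)` is weakly
decreasing in `z` (equivalently, `-X` is stochastically increasing). -/
def StochDecrFam {E F : Type*} [MeasurableSpace E] [Preorder E] [Preorder F]
    (κ : F → Measure E) : Prop :=
  ∀ z₁ z₂ : F, z₁ ≤ z₂ → ∀ x : E, κ z₂ {w | x ≤ w} ≤ κ z₁ {w | x ≤ w}

/-- Covariance of two real functionals under a measure. -/
def covFn {E : Type*} [MeasurableSpace E] (μ : Measure E) (f g : E → ℝ) : ℝ :=
  ∫ x, f x * g x ∂μ - (∫ x, f x ∂μ) * (∫ x, g x ∂μ)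

/-- A measure on a real normed space is Gaussian (jointly normal, possibly degenerate) if
every continuous linear functional pushes it forward to a one-dimensional Gaussian law. -/
def IsGaussianMeasure {E : Type*} [NormedAddCommGroup E] [NormedSpace ℝ E]
    [MeasurableSpace E] (μ : Measure E) : Prop :=
  ∀ L : E →L[ℝ] ℝ, ∃ m : ℝ, ∃ v : NNReal, μ.map (fun x => L x) = gaussianReal m v

/-- The law of `n` i.i.d. Poisson(`lam`) variables. -/
def iidPoisson (n : ℕ) (lam : ℝ) : Measure (Fin n → ℕ) :=
  Measure.pi fun _ => (poissonPMF (Real.toNNReal lam)).toMeasure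

open Complex in
lemma exp_quad_tendsto (h : ℕ → ℂ) (h0 : ∀ᶠ n in atTop, h n ≠ 0) (hh : Tendsto h atTop (𝓝 0))
    (c : ℕ → ℂ) (c0 : ℂ) (hc : Tendsto c atTop (𝓝 c0)) :
    Tendsto (fun n => (exp (h n * c n) - 1 - h n * c n) / (h n) ^ 2) atTop (𝓝 (c0 ^ 2 / 2)) := by
  have hz : Tendsto (fun n => h n * c n) atTop (𝓝 0) := by simpa using hh.mul hc
  have key : Tendsto (fun n => (exp (h n * c n) - 1 - h n * c n - (h n * c n) ^ 2 / 2) / (h n) ^ 2)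
      atTop (𝓝 0) := by
    have hb : Tendsto (fun n => ‖h n‖ * ‖c n‖ ^ 3 * Real.exp ‖h n * c n‖) atTop (𝓝 0) := by
      have := ((hh.norm).mul (hc.norm.pow 3)).mul (Real.continuous_exp.continuousAt.tendsto.comp hz.norm)
      simpa using this
    refine squeeze_zero_norm' ?_ hb
    filter_upwards [h0] with n hn
    have := Complex.norm_exp_sub_sum_le_norm_mul_exp (h n * c n) 3
    have e : exp (h n * c n) - ∑ m ∈ Finset.range 3, (h n * c n) ^ m / (m.factorial : ℂ)
        = exp (h n * c n) - 1 - h n * c n - (h n * c n) ^ 2 / 2 := by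
      simp [Finset.sum_range_succ, Nat.factorial]; ring
    rw [e] at this
    rw [norm_div, norm_pow, div_le_iff₀ (by positivity)]
    refine this.trans (le_of_eq ?_)
    rw [norm_mul]; ring
  have h2 : Tendsto (fun n => (c n) ^ 2 / 2) atTop (𝓝 (c0 ^ 2 / 2)) := (hc.pow 2).div_const 2
  have := key.add h2
  rw [zero_add] at this
  refine this.congr' ?_
  filter_upwards [h0] with n hn
  field_simp
  ring

open Complex in
lemma exp_lin_tendsto (h : ℕ → ℂ) (h0 : ∀ᶠ n in atTop, h n ≠ 0) (hh : Tendsto h atTop (𝓝 0))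
    (c : ℕ → ℂ) (c0 : ℂ) (hc : Tendsto c atTop (𝓝 c0)) :
    Tendsto (fun n => (exp (h n * c n) - 1) / (h n)) atTop (𝓝 c0) := by
  have := (hh.mul (exp_quad_tendsto h h0 hh c c0 hc)).add hc
  rw [zero_mul, zero_add] at this
  refine this.congr' ?_
  filter_upwards [h0] with n hn
  field_simp
  ring

open Complex in
/-- The characteristic function of the centered vector `(1{N=0} - e^{-r}, N - r)`. -/
def phi (s t : ℂ) (r : ℂ) : ℂ :=
  exp (-(I * (s * exp (-r) + t * r))) * (exp (r * (exp (I * t) - 1)) + exp (-r) * (exp (I * s) - 1))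

open Complex in
lemma phi_tendsto (h : ℕ → ℂ) (h0 : ∀ᶠ n in atTop, h n ≠ 0) (hh : Tendsto h atTop (𝓝 0))
    (r : ℕ → ℂ) (r0 : ℂ) (hr : Tendsto r atTop (𝓝 r0)) (s t : ℂ) :
    Tendsto (fun n => (phi (h n * s) (h n * t) (r n) - 1) / (h n) ^ 2) atTop
      (𝓝 (-(s ^ 2 * exp (-r0) * (1 - exp (-r0)) + r0 * t ^ 2 - 2 * s * t * exp (-r0) * r0) / 2)) := by
  have hp : Tendsto (fun n => exp (-r n)) atTop (𝓝 (exp (-r0))) :=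
    (Complex.continuous_exp.tendsto _).comp hr.neg
  have ht := exp_quad_tendsto h h0 hh (fun _ => I * t) (I * t) tendsto_const_nhds
  have hs := exp_quad_tendsto h h0 hh (fun _ => I * s) (I * s) tendsto_const_nhds
  have huc : Tendsto (fun n => -(I * (s * exp (-r n) + t * r n))) atTop
      (𝓝 (-(I * (s * exp (-r0) + t * r0)))) :=
    (((hp.const_mul s).add (hr.const_mul t)).const_mul I).neg
  have hu := exp_lin_tendsto h h0 hh _ _ huc
  have hu1 : Tendsto (fun n => exp (h n * -(I * (s * exp (-r n) + t * r n)))) atTop (𝓝 1) := by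
    have := (Complex.continuous_exp.tendsto _).comp (hh.mul huc)
    rw [zero_mul, Complex.exp_zero] at this
    exact this
  have hzc : Tendsto (fun n => h n * (r n * ((exp (h n * (I * t)) - 1 - h n * (I * t)) / (h n) ^ 2))
      - I * s * exp (-r n)) atTop (𝓝 (0 * (r0 * ((I * t) ^ 2 / 2)) - I * s * exp (-r0))) :=
    (hh.mul (hr.mul ht)).sub (hp.const_mul _)
  have hz := exp_quad_tendsto h h0 hh _ _ hzc
  have tot := ((hz.add (hr.mul ht)).add ((hp.mul hs).mul hu1)).add ((hp.const_mul (I * s)).mul hu)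
  refine (tot.congr' ?_).trans (le_of_eq ?_)
  · filter_upwards [h0] with n hn
    have e1 : h n * (h n * (r n * ((exp (h n * (I * t)) - 1 - h n * (I * t)) / (h n) ^ 2))
      - I * s * exp (-r n)) = h n * -(I * (s * exp (-r n) + t * r n)) +
        (r n * (exp (I * (h n * t)) - 1)) := by
      rw [show I * (h n * t) = h n * (I * t) by ring]
      field_simp
      ring
    rw [e1, Complex.exp_add, phi]
    rw [show I * (h n * t) = h n * (I * t) by ring, show I * (h n * s) = h n * (I * s) by ring,
      show -(I * (h n * s * exp (-r n) + h n * t * r n)) = h n * -(I * (s * exp (-r n) + t * r n)) by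
        ring]
    generalize exp (h n * -(I * (s * exp (-r n) + t * r n))) = U
    generalize exp (r n * (exp (h n * (I * t)) - 1)) = V
    generalize exp (h n * (I * t)) = T
    generalize exp (h n * (I * s)) = S
    field_simp
    ring
  · congr 1
    generalize exp (-r0) = p
    ring_nf
    simp only [Complex.I_sq]
    ring

lemma poissonPMF_toMeasure (r : NNReal) : (poissonPMF r).toMeasure = poissonMeasure r := by
  refine Measure.ext_of_singleton fun k => ?_
  rw [PMF.toMeasure_apply_singleton _ _ (measurableSet_singleton k), poissonMeasure_singleton,
    ← poissonPMFReal_ofReal_eq_poissonPMF, poissonPMFReal]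

open Complex in
lemma integral_poisson_phi (r : ℝ) (hr : 0 < r) (s t : ℝ) :
    ∫ k : ℕ, exp (I * (s * ((if k = 0 then 1 else 0) - exp (-r)) + t * (k - r)))
      ∂(poissonPMF r.toNNReal).toMeasure = phi s t r := by
  rw [poissonPMF_toMeasure]
  have e : ∀ k : ℕ, exp (I * (s * ((if k = 0 then 1 else 0) - exp (-r)) + t * (k - r)))
      = exp (-(I * (s * exp (-r) + t * r))) * (exp (k * t * I) +
        Set.indicator {0} (fun _ => (exp (I * s) - 1)) k) := by
    intro k
    by_cases hk : k = 0
    · subst hk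
      simp only [if_true, Set.indicator_of_mem (Set.mem_singleton 0)]
      rw [Nat.cast_zero, zero_mul, zero_mul, Complex.exp_zero, add_sub_cancel, ← Complex.exp_add]
      congr 1; ring
    · rw [Set.indicator_of_notMem (by simpa using hk), if_neg hk, add_zero, ← Complex.exp_add]
      congr 1; ring
  simp_rw [e]
  have i1 : Integrable (fun k : ℕ => exp (k * t * I)) (poissonMeasure r.toNNReal) := by
    refine Integrable.of_bound (C := 1) .of_discrete (ae_of_all _ fun k => ?_)
    rw [show (k * t * I : ℂ) = ((k * t : ℝ) : ℂ) * I by push_cast; ring, Complex.norm_exp_ofReal_mul_I]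
  have i2 : Integrable (Set.indicator {0} (fun _ : ℕ => (exp (I * s) - 1)))
      (poissonMeasure r.toNNReal) :=
    (integrable_const _).indicator (measurableSet_singleton _)
  rw [integral_const_mul, integral_add i1 i2, integral_indicator_const _ (measurableSet_singleton _)]
  have c := charFun_map_cast_poissonMeasure r.toNNReal t
  rw [charFun_apply, integral_map .of_discrete (by fun_prop)] at c
  rw [poissonMeasure_real_singleton, phi]
  have c' : ∫ k : ℕ, exp (k * t * I) ∂(poissonMeasure r.toNNReal) = exp (r * (exp (I * t) - 1)) := by
    rw [Real.coe_toNNReal _ hr.le] at c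
    rw [mul_comm I, ← c]
    refine integral_congr_ae (ae_of_all _ fun k => ?_)
    simp [mul_comm]
  rw [c', Real.coe_toNNReal _ hr.le]
  simp

def covS (lam : ℝ) : Matrix (Fin 2) (Fin 2) ℝ :=
  !![Real.exp (-lam) * (1 - Real.exp (-lam)), -lam * Real.exp (-lam);
     -lam * Real.exp (-lam), lam]

lemma covS_quad (lam : ℝ) (x : Fin 2 → ℝ) : x ⬝ᵥ (covS lam).mulVec x =
    x 0 ^ 2 * Real.exp (-lam) * (1 - Real.exp (-lam)) + lam * x 1 ^ 2
      - 2 * x 0 * x 1 * Real.exp (-lam) * lam := by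
  simp [covS, Matrix.mulVec, dotProduct, Fin.sum_univ_two]
  ring

lemma covS_posSemidef (lam : ℝ) (hlam : 0 < lam) : (covS lam).PosSemidef := by
  refine Matrix.PosSemidef.of_dotProduct_mulVec_nonneg ?_ fun x => ?_
  · ext i j
    fin_cases i <;> fin_cases j <;> simp [covS]
  · rw [star_trivial, covS_quad]
    have hp := Real.exp_pos (-lam)
    have h1 : Real.exp (-lam) * (1 + lam) ≤ 1 := by
      have := Real.add_one_le_exp lam
      calc Real.exp (-lam) * (1 + lam) ≤ Real.exp (-lam) * Real.exp lam := by gcongr; linarith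
        _ = 1 := by rw [← Real.exp_add]; simp
    generalize Real.exp (-lam) = p at *
    have : x 0 ^ 2 * p * (1 - p) + lam * x 1 ^ 2 - 2 * x 0 * x 1 * p * lam
      = lam * (x 1 - p * x 0) ^ 2 + x 0 ^ 2 * p * (1 - p * (1 + lam)) := by ring
    rw [this]
    have : 0 ≤ 1 - p * (1 + lam) := by linarith
    positivity

abbrev E2 := EuclideanSpace ℝ (Fin 2)

def toProd : E2 →L[ℝ] ℝ × ℝ :=
  (EuclideanSpace.proj (0 : Fin 2)).prod (EuclideanSpace.proj (1 : Fin 2))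

lemma toProd_apply (x : E2) : toProd x = (x 0, x 1) := rfl

/-- The rescaled vector in Euclidean space. -/
def vecE (n : ℕ) (r : ℝ) (ω : Fin n → ℕ) : E2 :=
  !₂[(Real.sqrt n)⁻¹ *
              (((Finset.univ.filter fun k : Fin n => ω k = 0).card : ℝ) -
                n * Real.exp (-r)),
             (Real.sqrt n)⁻¹ * (((∑ k, ω k : ℕ) : ℝ) - n * r)]

instance (n : ℕ) (r : ℝ) : IsProbabilityMeasure (iidPoisson n r) := by
  unfold iidPoisson; infer_instance

lemma measurable_vecE (n : ℕ) (r : ℝ) : Measurable (vecE n r) := .of_discrete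

open Complex in
lemma charFun_vecE (n : ℕ) (r : ℝ) (hr : 0 < r) (x : E2) :
    charFun ((iidPoisson n r).map (vecE n r)) x =
      phi (((Real.sqrt n)⁻¹ : ℝ) * (x 0 : ℝ)) (((Real.sqrt n)⁻¹ : ℝ) * (x 1 : ℝ)) r ^ n := by
  rw [charFun_apply, integral_map (measurable_vecE n r).aemeasurable (by fun_prop)]
  have e : ∀ ω : Fin n → ℕ, exp ((inner ℝ (vecE n r ω) x : ℝ) * I) =
      ∏ k, exp (I * (((Real.sqrt n)⁻¹ * x 0 : ℝ) * ((if ω k = 0 then 1 else 0) - exp (-r))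
        + ((Real.sqrt n)⁻¹ * x 1 : ℝ) * (ω k - r))) := by
    intro ω
    rw [← Complex.exp_sum]
    congr 1
    rw [← Finset.mul_sum, Finset.sum_add_distrib, ← Finset.mul_sum, ← Finset.mul_sum,
      Finset.sum_sub_distrib, Finset.sum_sub_distrib]
    simp [vecE, PiLp.inner_apply, Fin.sum_univ_two]
    ring
  simp_rw [e]
  rw [iidPoisson, integral_fintype_prod_eq_prod (𝕜 := ℂ)
    (f := fun (_ : Fin n) (k : ℕ) => exp (I * (((Real.sqrt n)⁻¹ * x 0 : ℝ) * ((if k = 0 then 1 else 0) - exp (-r))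
        + ((Real.sqrt n)⁻¹ * x 1 : ℝ) * (k - r))))]
  simp_rw [integral_poisson_phi r hr]
  simp

lemma vecE_tendsto (lamn : ℕ → ℝ) (hpos : ∀ n, 0 < lamn n)
    (lam : ℝ) (hlam : 0 < lam) (hconv : Tendsto lamn atTop (𝓝 lam)) (f : BoundedContinuousFunction E2 ℝ) :
    Tendsto (fun n => ∫ x, f x ∂((iidPoisson n (lamn n)).map (vecE n (lamn n)))) atTop
      (𝓝 (∫ x, f x ∂(multivariateGaussian 0 (covS lam)))) := by
  have hP : ∀ n, IsProbabilityMeasure ((iidPoisson n (lamn n)).map (vecE n (lamn n))) := fun n =>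
    Measure.isProbabilityMeasure_map (measurable_vecE _ _).aemeasurable
  let μ : ℕ → ProbabilityMeasure E2 := fun n => ⟨_, hP n⟩
  let μ₀ : ProbabilityMeasure E2 := ⟨multivariateGaussian 0 (covS lam), inferInstance⟩
  have : Tendsto μ atTop (𝓝 μ₀) := by
    refine ProbabilityMeasure.tendsto_iff_tendsto_charFun.2 fun t => ?_
    change Tendsto (fun n => charFun ((iidPoisson n (lamn n)).map (vecE n (lamn n))) t) atTop
      (𝓝 (charFun (multivariateGaussian 0 (covS lam)) t))
    simp_rw [charFun_vecE _ _ (hpos _), charFun_multivariateGaussian (covS_posSemidef lam hlam)]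
    have hh : Tendsto (fun n : ℕ => (((Real.sqrt n)⁻¹ : ℝ) : ℂ)) atTop (𝓝 0) := by
      rw [← Complex.ofReal_zero]
      exact (Complex.continuous_ofReal.tendsto _).comp (tendsto_inv_atTop_zero.comp
        (Real.tendsto_sqrt_atTop.comp tendsto_natCast_atTop_atTop))
    have h0 : ∀ᶠ n : ℕ in atTop, (((Real.sqrt n)⁻¹ : ℝ) : ℂ) ≠ 0 := by
      filter_upwards [eventually_gt_atTop 0] with n hn
      have : 0 < Real.sqrt n := Real.sqrt_pos.2 (by exact_mod_cast hn)
      exact_mod_cast (inv_pos.2 this).ne'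
    have key := phi_tendsto _ h0 hh (fun n => (lamn n : ℂ)) lam
      ((Complex.continuous_ofReal.tendsto _).comp hconv) (t 0) (t 1)
    have key2 := Complex.tendsto_one_add_pow_exp_of_tendsto
      (g := fun n : ℕ => phi (((Real.sqrt n)⁻¹ : ℝ) * (t 0 : ℝ)) (((Real.sqrt n)⁻¹ : ℝ) * (t 1 : ℝ)) (lamn n) - 1)
      (key.congr fun n => ?_)
    · simp only [add_sub_cancel] at key2
      refine key2.trans (le_of_eq ?_)
      rw [covS_quad]
      congr 2
      push_cast
      simp
      ring
    · rw [← Complex.ofReal_pow, inv_pow, Real.sq_sqrt (Nat.cast_nonneg n)]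
      push_cast
      rw [div_inv_eq_mul, mul_comm]
  exact (ProbabilityMeasure.tendsto_iff_forall_integral_tendsto.1 this) f

/-- Joint CLT for the number of empty boxes and the total number of balls in the
Poissonized allocation model (display (3.1) in Example 3.1). -/
theorem poissonized_allocation_joint_clt
    (lamn : ℕ → ℝ) (hpos : ∀ n, 0 < lamn n)
    (lam : ℝ) (hlam : 0 < lam) (hconv : Tendsto lamn atTop (𝓝 lam)) :
    ∃ ν : Measure (ℝ × ℝ),
      IsProbabilityMeasure ν ∧ IsGaussianMeasure ν ∧
      (∫ p, p.1 ∂ν) = 0 ∧ (∫ p, p.2 ∂ν) = 0 ∧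
      covFn ν (fun p => p.1) (fun p => p.1) = Real.exp (-lam) * (1 - Real.exp (-lam)) ∧
      covFn ν (fun p => p.2) (fun p => p.2) = lam ∧
      covFn ν (fun p => p.1) (fun p => p.2) = -lam * Real.exp (-lam) ∧
      TendstoInDistribution
        (fun n => (iidPoisson n (lamn n)).map
          (fun ω =>
            ((Real.sqrt n)⁻¹ *
              (((Finset.univ.filter fun k : Fin n => ω k = 0).card : ℝ) -
                n * Real.exp (-(lamn n))),
             (Real.sqrt n)⁻¹ * (((∑ k, ω k : ℕ) : ℝ) - n * lamn n))))
        ν := by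
  have hS := covS_posSemidef lam hlam
  set μ := multivariateGaussian 0 (covS lam) with hμ
  have hm : Measurable toProd := toProd.continuous.measurable
  have hprob : IsProbabilityMeasure (μ.map toProd) :=
    Measure.isProbabilityMeasure_map hm.aemeasurable
  have hint : ∀ i : Fin 2, ∫ x : E2, x i ∂μ = 0 := by
    intro i
    have h := (EuclideanSpace.proj i : E2 →L[ℝ] ℝ).integral_comp_id_comm
      (μ := μ) IsGaussian.integrable_id
    rw [integral_id_multivariateGaussian] at h
    simpa using h
  have hL2 : ∀ i : Fin 2, MemLp (fun x : E2 => x i) 2 μ := fun i =>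
    IsGaussian.memLp_dual μ (EuclideanSpace.proj i : E2 →L[ℝ] ℝ) 2 (by simp)
  have hcov : ∀ i j : Fin 2, ∫ x : E2, x i * x j ∂μ = covS lam i j := by
    intro i j
    rw [← covariance_eval_multivariateGaussian (μ := 0) hS i j, ← hμ,
      covariance_eq_sub (hL2 i) (hL2 j), hint i]
    simp
  have I1 : ∀ g : ℝ × ℝ → ℝ, Continuous g →
      ∫ p, g p ∂(μ.map toProd) = ∫ x : E2, g (x 0, x 1) ∂μ := by
    intro g hg
    rw [integral_map hm.aemeasurable hg.aestronglyMeasurable]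
    rfl
  have c1 : ∫ p, p.1 ∂(μ.map toProd) = 0 := by
    rw [I1 (fun p => p.1) continuous_fst]; exact hint 0
  have c2 : ∫ p, p.2 ∂(μ.map toProd) = 0 := by
    rw [I1 (fun p => p.2) continuous_snd]; exact hint 1
  refine ⟨μ.map toProd, hprob, ?_, c1, c2, ?_, ?_, ?_, ?_⟩
  · intro L
    rw [Measure.map_map (by fun_prop) hm]
    exact ⟨_, _, IsGaussian.map_eq_gaussianReal (L.comp toProd)⟩
  · rw [covFn, c1, I1 (fun p => p.1 * p.1) (by fun_prop), hcov 0 0]; simp [covS]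
  · rw [covFn, c2, I1 (fun p => p.2 * p.2) (by fun_prop), hcov 1 1]; simp [covS]
  · rw [covFn, c1, I1 (fun p => p.1 * p.2) (by fun_prop), hcov 0 1]; simp [covS]
  · intro f
    have := vecE_tendsto lamn hpos lam hlam hconv (f.compContinuous ⟨toProd, toProd.continuous⟩)
    rw [integral_map hm.aemeasurable f.continuous.aestronglyMeasurable]
    refine this.congr fun n => ?_
    rw [integral_map (measurable_vecE _ _).aemeasurable (by fun_prop),
      integral_map (Measurable.of_discrete).aemeasurable (by fun_prop)]
    rfl
end
end

section
/- Consider the random graph G(n, p) with p = p(n) = λ_n/n, where λ_n → λ for some λ > 0, and for k ≥ 0 let N_k = N_k(n) be the number of vertices of degree k. Then for every fixed K ≥ 0, the random vector (n^{-1/2}(N_k − n π_{λ_n}(k)))_{k=0}^{K} converges in distribution to a centered Gaussian vector (U_0,…,U_K) with covariances Cov(U_j, U_k) = σ_{jk} := π_λ(j) π_λ(k) ((j−λ)(k−λ)/λ − 1) + π_λ(k) δ_{jk}. -/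
open MeasureTheory ProbabilityTheory Filter Topology

noncomputable section

open scoped ENNReal

/-- The index type for potential edges of a graph on `Fin n`: unordered pairs of distinct
vertices. -/
abbrev EdgeIdx (n : ℕ) := {e : Sym2 (Fin n) // ¬ e.IsDiag}

/-- The Erdős–Rényi measure `G(n,p)`: each potential edge is present independently with
probability `p`; a graph is encoded as its edge indicator `S : EdgeIdx n → Bool`. -/
def gnpMeasure (n : ℕ) (p : ℝ) : Measure (EdgeIdx n → Bool) :=
  ∑ S : EdgeIdx n → Bool,
    (∏ e : EdgeIdx n, if S e then ENNReal.ofReal p else ENNReal.ofReal (1 - p)) •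
      Measure.dirac S

/-- The number of edges of the graph `S`. -/
def edgeCount (n : ℕ) (S : EdgeIdx n → Bool) : ℕ :=
  (Finset.univ.filter fun e : EdgeIdx n => S e = true).card

/-- The uniform measure `G(n,m)` on graphs on `Fin n` with exactly `m` edges. -/
def gnmMeasure (n m : ℕ) : Measure (EdgeIdx n → Bool) :=
  ∑ S : EdgeIdx n → Bool,
    (if edgeCount n S = m then
        ((Finset.univ.filter fun S' : EdgeIdx n → Bool => edgeCount n S' = m).card :
          ℝ≥0∞)⁻¹
      else 0) • Measure.dirac S

/-- The degree of the vertex `v` in the graph `S`. -/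
def degree (n : ℕ) (S : EdgeIdx n → Bool) (v : Fin n) : ℕ :=
  (Finset.univ.filter fun e : EdgeIdx n => S e = true ∧ v ∈ (e : Sym2 (Fin n))).card

/-- The number of vertices of degree `k` in the graph `S`. -/
def degCount (n : ℕ) (k : ℕ) (S : EdgeIdx n → Bool) : ℕ :=
  (Finset.univ.filter fun v : Fin n => degree n S v = k).card

/-- The Poisson point probabilities `π_λ(k) = e^{-λ} λ^k / k!`. -/
def poissonProb (lam : ℝ) (k : ℕ) : ℝ :=
  Real.exp (-lam) * lam ^ k / (k.factorial : ℝ)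


section ProductSpace

variable {ι : Type*} [Fintype ι] [DecidableEq ι]

/-- Bernoulli product weight. -/
def wt (p : ℝ) (S : ι → Bool) : ℝ := ∏ e, (if S e then p else 1 - p)

/-- Expectation under the Bernoulli product weight. -/
def Ex {E : Type*} [NormedAddCommGroup E] [NormedSpace ℝ E] (p : ℝ) (F : (ι → Bool) → E) : E :=
  ∑ S, wt p S • F S

/-- Discrete derivative. -/
def Dd {E : Type*} [NormedAddCommGroup E] (e : ι) (F : (ι → Bool) → E) (S : ι → Bool) : E :=
  F (Function.update S e true) - F (Function.update S e false)

lemma wt_nonneg {p : ℝ} (h0 : 0 ≤ p) (h1 : p ≤ 1) (S : ι → Bool) : 0 ≤ wt p S := by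
  unfold wt
  refine Finset.prod_nonneg fun e _ => ?_
  split_ifs <;> linarith

lemma sum_wt (p : ℝ) : ∑ S : ι → Bool, wt p S = 1 := by
  unfold wt
  have := Finset.prod_univ_sum (fun _ : ι => (Finset.univ : Finset Bool))
    (fun _ b => if b then p else 1 - p)
  rw [Fintype.piFinset_univ] at this
  rw [← this]
  simp

variable {E : Type*} [NormedAddCommGroup E] [NormedSpace ℝ E]

lemma Ex_add (p : ℝ) (F G : (ι → Bool) → E) :
    Ex p (fun S => F S + G S) = Ex p F + Ex p G := by
  simp [Ex, Finset.sum_add_distrib]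

lemma Ex_sub (p : ℝ) (F G : (ι → Bool) → E) :
    Ex p (fun S => F S - G S) = Ex p F - Ex p G := by
  simp [Ex, Finset.sum_sub_distrib, smul_sub]

lemma Ex_neg (p : ℝ) (F : (ι → Bool) → E) :
    Ex p (fun S => - F S) = - Ex p F := by
  simp [Ex]

lemma Ex_smul (p c : ℝ) (F : (ι → Bool) → E) :
    Ex p (fun S => c • F S) = c • Ex p F := by
  simp only [Ex, Finset.smul_sum]
  exact Finset.sum_congr rfl fun S _ => smul_comm _ _ _

lemma Ex_mul_left (p c : ℝ) (F : (ι → Bool) → ℝ) :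
    Ex p (fun S => c * F S) = c * Ex p F := Ex_smul p c F

lemma Ex_cmul_left (p : ℝ) (c : ℂ) (F : (ι → Bool) → ℂ) :
    Ex p (fun S => c * F S) = c * Ex p F := by
  simp only [Ex, Finset.mul_sum]
  exact Finset.sum_congr rfl fun S _ => (mul_smul_comm _ _ _).symm

lemma Ex_sum {κ : Type*} (s : Finset κ) (p : ℝ) (F : κ → (ι → Bool) → E) :
    Ex p (fun S => ∑ i ∈ s, F i S) = ∑ i ∈ s, Ex p (F i) := by
  simp only [Ex, Finset.smul_sum]
  exact Finset.sum_comm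

lemma Ex_const (p : ℝ) (c : E) : Ex p (fun _ : ι → Bool => c) = c := by
  simp [Ex, ← Finset.sum_smul, sum_wt]

lemma Ex_mono {p : ℝ} (h0 : 0 ≤ p) (h1 : p ≤ 1) {F G : (ι → Bool) → ℝ} (h : ∀ S, F S ≤ G S) :
    Ex p F ≤ Ex p G :=
  Finset.sum_le_sum fun S _ => mul_le_mul_of_nonneg_left (h S) (wt_nonneg h0 h1 S)

lemma norm_Ex_le {p : ℝ} (h0 : 0 ≤ p) (h1 : p ≤ 1) (F : (ι → Bool) → E) :
    ‖Ex p F‖ ≤ Ex p (fun S => ‖F S‖) := by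
  refine (norm_sum_le _ _).trans (le_of_eq ?_)
  refine Finset.sum_congr rfl fun S _ => ?_
  rw [norm_smul, Real.norm_of_nonneg (wt_nonneg h0 h1 S), smul_eq_mul]

lemma norm_Ex_le_of_le {p : ℝ} (h0 : 0 ≤ p) (h1 : p ≤ 1) {F : (ι → Bool) → E} {C : ℝ}
    (h : ∀ S, ‖F S‖ ≤ C) : ‖Ex p F‖ ≤ C :=
  (norm_Ex_le h0 h1 F).trans ((Ex_mono h0 h1 h).trans_eq (Ex_const p C))

/-- Conditional averaging over a coordinate. -/
def av (p : ℝ) (e : ι) (F : (ι → Bool) → E) (S : ι → Bool) : E :=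
  (1 - p) • F (Function.update S e false) + p • F (Function.update S e true)

lemma wt_split (p : ℝ) (e : ι) (S : ι → Bool) :
    wt p S = (if S e then p else 1 - p) *
      ∏ x ∈ Finset.univ.erase e, (if S x then p else 1 - p) := by
  unfold wt
  rw [Finset.mul_prod_erase _ (fun x => if S x then p else 1 - p) (Finset.mem_univ e)]

lemma Ex_av (p : ℝ) (e : ι) (F : (ι → Bool) → E) : Ex p (av p e F) = Ex p F := by
  let q : Bool → ℝ := fun b => if b then p else 1 - p
  let R : (ι → Bool) → ℝ := fun S => ∏ x ∈ Finset.univ.erase e, q (S x)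
  have hR : ∀ S b, R (Function.update S e b) = R S := by
    intro S b
    refine Finset.prod_congr rfl fun x hx => ?_
    rw [Function.update_of_ne (Finset.ne_of_mem_erase hx)]
  have hw : ∀ S, wt p S = q (S e) * R S := wt_split p e
  have h1 : Ex p (av p e F) =
      ∑ x : (ι → Bool) × Bool, (q (x.1 e) * R x.1 * q x.2) • F (Function.update x.1 e x.2) := by
    rw [Fintype.sum_prod_type]
    refine Finset.sum_congr rfl fun S _ => ?_
    rw [hw]
    simp only [av, Fintype.sum_bool, q, mul_smul, smul_add]
    simp [add_comm]
  have h2 : Ex p F = ∑ x : (ι → Bool) × Bool, (q (x.1 e) * R x.1 * q x.2) • F x.1 := by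
    rw [Fintype.sum_prod_type]
    refine Finset.sum_congr rfl fun S _ => ?_
    rw [hw]
    simp only [Fintype.sum_bool, ← add_smul, ← mul_add]
    simp [q]
  rw [h1, h2]
  let σ : (ι → Bool) × Bool → (ι → Bool) × Bool := fun x => (Function.update x.1 e x.2, x.1 e)
  have hσ : Function.Involutive σ := by
    rintro ⟨S, b⟩
    simp [σ]
  refine Fintype.sum_equiv hσ.toPerm _ _ fun x => ?_
  simp only [Function.Involutive.coe_toPerm, σ, hR, Function.update_self]
  congr 1
  ring

lemma update_cases (S : ι → Bool) (e : ι) :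
    (S e = false ∧ Function.update S e false = S) ∨ (S e = true ∧ Function.update S e true = S) := by
  cases h : S e
  · left; exact ⟨rfl, by rw [← h, Function.update_eq_self]⟩
  · right; exact ⟨rfl, by rw [← h, Function.update_eq_self]⟩

/-- Variance split along one coordinate. -/
lemma Ex_sq_av (p : ℝ) (e : ι) (F : (ι → Bool) → ℝ) :
    Ex p (fun S => F S ^ 2) - Ex p (fun S => av p e F S ^ 2)
      = p * (1 - p) * Ex p (fun S => Dd e F S ^ 2) := by
  rw [← Ex_av p e (fun S => F S ^ 2), ← Ex_sub, ← Ex_mul_left]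
  congr 1
  funext S
  simp only [av, Dd, smul_eq_mul]
  ring

lemma Ex_av_sq_le {p : ℝ} (h0 : 0 ≤ p) (h1 : p ≤ 1) (e : ι) (F : (ι → Bool) → ℝ) :
    Ex p (fun S => av p e F S ^ 2) ≤ Ex p (fun S => F S ^ 2) := by
  have h := Ex_sq_av p e F
  have h2 : 0 ≤ Ex p (fun S => Dd e F S ^ 2) := by
    rw [← Ex_const (ι := ι) p (0 : ℝ)]
    exact Ex_mono h0 h1 fun S => sq_nonneg _
  have : 0 ≤ p * (1 - p) := mul_nonneg h0 (by linarith)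
  nlinarith [mul_nonneg this h2]

lemma Dd_av_sq_le {p : ℝ} (h0 : 0 ≤ p) (h1 : p ≤ 1) (e f : ι) (F : (ι → Bool) → ℝ) :
    Ex p (fun S => Dd f (av p e F) S ^ 2) ≤ Ex p (fun S => Dd f F S ^ 2) := by
  by_cases hef : f = e
  · subst hef
    refine Ex_mono h0 h1 fun S => ?_
    have : Dd f (av p f F) S = 0 := by simp [Dd, av]
    rw [this]
    simpa using sq_nonneg _
  · have : Dd f (av p e F) = av p e (Dd f F) := by
      funext S
      simp only [Dd, av, smul_eq_mul, Function.update_comm hef]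
      ring
    rw [this]
    exact Ex_av_sq_le h0 h1 e _

/-- Iterated averaging. -/
def avL (p : ℝ) : List ι → ((ι → Bool) → ℝ) → ((ι → Bool) → ℝ)
  | [], F => F
  | e :: l, F => avL p l (av p e F)

lemma Ex_avL (p : ℝ) (l : List ι) (F : (ι → Bool) → ℝ) : Ex p (avL p l F) = Ex p F := by
  induction l generalizing F with
  | nil => rfl
  | cons e l ih => rw [avL, ih, Ex_av]

lemma avL_sq {p : ℝ} (h0 : 0 ≤ p) (h1 : p ≤ 1) (l : List ι) (F : (ι → Bool) → ℝ) :
    Ex p (fun S => F S ^ 2) - Ex p (fun S => avL p l F S ^ 2) ≤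
      p * (1 - p) * (l.map fun e => Ex p (fun S => Dd e F S ^ 2)).sum := by
  induction l generalizing F with
  | nil => simp [avL]
  | cons e l ih =>
    have h := ih (av p e F)
    have h2 := Ex_sq_av p e F
    have h3 : (l.map fun f => Ex p (fun S => Dd f (av p e F) S ^ 2)).sum ≤
        (l.map fun f => Ex p (fun S => Dd f F S ^ 2)).sum :=
      List.sum_le_sum fun f _ => Dd_av_sq_le h0 h1 e f F
    have : 0 ≤ p * (1 - p) := mul_nonneg h0 (by linarith)
    have h4 := mul_le_mul_of_nonneg_left h3 this
    simp only [avL, List.map_cons, List.sum_cons]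
    linarith

/-- independence from the coordinate `e`. -/
lemma avL_indep (p : ℝ) (l : List ι) (F : (ι → Bool) → ℝ) (e : ι)
    (h : e ∈ l ∨ ∀ S b, F (Function.update S e b) = F S) (S : ι → Bool) (b : Bool) :
    avL p l F (Function.update S e b) = avL p l F S := by
  induction l generalizing F with
  | nil => simpa [avL] using h.resolve_left (by simp) S b
  | cons f l ih =>
    rw [avL]
    by_cases hl : e ∈ l
    · exact ih _ (Or.inl hl)
    refine ih _ (Or.inr ?_)
    intro S b
    by_cases hf : e = f
    · subst hf; simp [av]
    · have h' : ∀ S b, F (Function.update S e b) = F S := by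
        rcases h with h | h
        · simp [hf, hl] at h
        · exact h
      simp only [av]
      rw [Function.update_comm hf, Function.update_comm hf, h', h']

lemma const_of_indep (G : (ι → Bool) → ℝ)
    (h : ∀ e S b, G (Function.update S e b) = G S) (S S' : ι → Bool) : G S = G S' := by
  have : ∀ s : Finset ι, G (s.piecewise S' S) = G S := by
    intro s
    induction s using Finset.induction_on with
    | empty => simp
    | insert a s _ ih => rw [Finset.piecewise_insert, h, ih]
  rw [← this Finset.univ, Finset.piecewise_univ]

/-- Efron-Stein inequality. -/
lemma efron_stein {p : ℝ} (h0 : 0 ≤ p) (h1 : p ≤ 1) (F : (ι → Bool) → ℝ) :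
    Ex p (fun S => F S ^ 2) - (Ex p F) ^ 2 ≤
      p * (1 - p) * ∑ e, Ex p (fun S => Dd e F S ^ 2) := by
  have h := avL_sq h0 h1 (Finset.univ : Finset ι).toList F
  rw [Finset.sum_map_toList] at h
  set G := avL p (Finset.univ : Finset ι).toList F with hG
  have hc : ∀ S S', G S = G S' := const_of_indep G fun e S b =>
    avL_indep p _ F e (Or.inl (by simp)) S b
  have hGc : G = fun _ => G (fun _ => false) := by funext S; exact hc _ _
  have hE : Ex p F = G (fun _ => false) := by
    rw [← Ex_avL p (Finset.univ : Finset ι).toList F, ← hG, hGc, Ex_const]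
  have h2 : Ex p (fun S => G S ^ 2) = (Ex p F) ^ 2 := by
    rw [hE, hGc, Ex_const]
  linarith

/-- L1 deviation from a number. -/
lemma Ex_abs_sub_le {p : ℝ} (h0 : 0 ≤ p) (h1 : p ≤ 1) (F : (ι → Bool) → ℝ) (c V : ℝ)
    (hV : Ex p (fun S => F S ^ 2) - (Ex p F) ^ 2 ≤ V) :
    Ex p (fun S => |F S - c|) ≤ |Ex p F - c| + Real.sqrt V := by
  set m := Ex p F with hm
  have hA : Ex p (fun S => |F S - m|) ≤ Real.sqrt V := by
    refine Real.le_sqrt_of_sq_le (le_trans ?_ hV)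
    set a := Ex p (fun S => |F S - m|) with ha
    have : 0 ≤ Ex p (fun S => (|F S - m| - a) ^ 2) := by
      rw [← Ex_const (ι := ι) p (0 : ℝ)]
      exact Ex_mono h0 h1 fun S => sq_nonneg _
    have e1 : Ex p (fun S => (|F S - m| - a) ^ 2) =
        Ex p (fun S => F S ^ 2) - m ^ 2 - a ^ 2 := by
      have : (fun S => (|F S - m| - a) ^ 2) =
          fun S => ((F S ^ 2 - (2 * m) * F S) + m ^ 2) - ((2 * a) * |F S - m| - a ^ 2) := by
        funext S
        have := sq_abs (F S - m)
        nlinarith [this]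
      rw [this, Ex_sub, Ex_add, Ex_sub, Ex_sub, Ex_mul_left, Ex_mul_left, Ex_const, Ex_const,
        ← hm, ← ha]
      ring
    linarith
  calc Ex p (fun S => |F S - c|) ≤ Ex p (fun S => |m - c| + |F S - m|) :=
        Ex_mono h0 h1 fun S => by
          have := abs_add_le (F S - m) (m - c)
          rw [show F S - c = (F S - m) + (m - c) by ring]; linarith
    _ = |m - c| + Ex p (fun S => |F S - m|) := by rw [Ex_add, Ex_const]
    _ ≤ _ := by linarith

end ProductSpace

section PoissonStein

lemma hasSum_congr_aux {f g : ℕ → ℝ} {a : ℝ} (h : ∀ k, f k = g k) : HasSum f a ↔ HasSum g a := by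
  rw [funext h]

/-- Poisson expectation. -/
def Po (lam : ℝ) (f : ℕ → ℝ) : ℝ := ∑' k, poissonProb lam k * f k

lemma pp_nonneg {lam : ℝ} (h : 0 ≤ lam) (k : ℕ) : 0 ≤ poissonProb lam k := by
  unfold poissonProb; positivity

lemma hasSum_pp (lam : ℝ) : HasSum (poissonProb lam) 1 := by
  have h := (NormedSpace.expSeries_div_hasSum_exp (𝔸 := ℝ) lam).mul_left (Real.exp (-lam))
  rw [← Real.exp_eq_exp_ℝ, ← Real.exp_add] at h
  simp only [neg_add_cancel, Real.exp_zero] at h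
  have e : poissonProb lam = fun k => Real.exp (-lam) * (lam ^ k / (k.factorial : ℝ)) := by
    funext k
    simp only [poissonProb]
    ring
  rw [e]
  exact h

lemma summable_pp_mul {lam : ℝ} (h : 0 ≤ lam) {f : ℕ → ℝ} {M : ℝ} (hf : ∀ k, |f k| ≤ M) :
    Summable fun k => poissonProb lam k * f k := by
  refine Summable.of_norm_bounded ((hasSum_pp lam).summable.mul_right M) fun k => ?_
  rw [Real.norm_eq_abs, abs_mul, abs_of_nonneg (pp_nonneg h k)]
  exact mul_le_mul_of_nonneg_left (hf k) (pp_nonneg h k)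

lemma Po_const (lam c : ℝ) : Po lam (fun _ => c) = c := by
  unfold Po
  rw [tsum_mul_right, (hasSum_pp lam).tsum_eq, one_mul]

lemma Po_sub {lam : ℝ} (h : 0 ≤ lam) {f g : ℕ → ℝ} {M M' : ℝ} (hf : ∀ k, |f k| ≤ M)
    (hg : ∀ k, |g k| ≤ M') : Po lam (fun k => f k - g k) = Po lam f - Po lam g := by
  unfold Po
  simp only [mul_sub]
  exact (summable_pp_mul h hf).tsum_sub (summable_pp_mul h hg)

lemma Po_mul_left (lam c : ℝ) (f : ℕ → ℝ) : Po lam (fun k => c * f k) = c * Po lam f := by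
  unfold Po
  rw [← tsum_mul_left]
  congr 1; funext k; ring

lemma abs_Po_le {lam : ℝ} (h : 0 ≤ lam) {f : ℕ → ℝ} {M : ℝ} (hf : ∀ k, |f k| ≤ M) :
    |Po lam f| ≤ M := by
  have hs := summable_pp_mul h hf
  have hM : ∀ k : ℕ, |(fun _ : ℕ => M) k| ≤ |M| := fun k => le_rfl
  have h2 := summable_pp_mul h hM
  have h3 := Po_const lam M
  rw [abs_le]
  constructor
  · rw [← h3]
    unfold Po
    rw [← tsum_neg]
    refine h2.neg.tsum_le_tsum (fun k => ?_) hs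
    have := mul_le_mul_of_nonneg_left (abs_le.1 (hf k)).1 (pp_nonneg h k)
    linarith
  · refine le_trans ?_ h3.le
    unfold Po
    refine hs.tsum_le_tsum (fun k => ?_) h2
    exact mul_le_mul_of_nonneg_left (abs_le.1 (hf k)).2 (pp_nonneg h k)

lemma pp_succ (lam : ℝ) (k : ℕ) :
    poissonProb lam (k + 1) * ((k + 1 : ℕ) : ℝ) = lam * poissonProb lam k := by
  unfold poissonProb
  rw [Nat.factorial_succ, pow_succ]
  have : (k.factorial : ℝ) ≠ 0 := by positivity
  push_cast
  have : (k : ℝ) + 1 ≠ 0 := by positivity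
  field_simp

lemma hasSum_shift {lam : ℝ} (h : 0 ≤ lam) {f : ℕ → ℝ} {M : ℝ} (hf : ∀ k, |f k| ≤ M) :
    HasSum (fun k => poissonProb lam k * ((k : ℝ) * f k)) (lam * Po lam (fun k => f (k + 1))) := by
  have h1 := (summable_pp_mul h (f := fun k => f (k + 1)) (fun k => hf (k + 1))).hasSum.mul_left lam
  rw [← hasSum_nat_add_iff' 1]
  simp only [Finset.range_one, Finset.sum_singleton, Nat.cast_zero, zero_mul, mul_zero, sub_zero]
  refine (hasSum_congr_aux fun k => ?_).mp h1
  rw [← mul_assoc, ← mul_assoc, pp_succ]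

/-- Bounded solution of the Poisson Stein equation. -/
lemma stein_solution {lam : ℝ} (hl : 0 ≤ lam) {f : ℕ → ℝ} {M : ℝ} (hf : ∀ k, |f k| ≤ M) :
    ∃ u : ℕ → ℝ, (∀ k, |u k| ≤ 2 * M * Real.exp lam) ∧
      ∀ k : ℕ, lam * u k - k * u (k - 1) = f k - Po lam f := by
  have hM : 0 ≤ M := (abs_nonneg _).trans (hf 0)
  set F : ℕ → ℝ := fun k => f k - Po lam f with hF
  have hFb : ∀ k, |F k| ≤ 2 * M := fun k => by
    have h1 := abs_sub (f k) (Po lam f)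
    have h2 := hf k
    have h3 := abs_Po_le hl hf
    linarith
  let c : ℕ → ℕ → ℝ := fun k i => (k.factorial : ℝ) * lam ^ i / ((k + i).factorial : ℝ) * F (k + i)
  have hexp : HasSum (fun i : ℕ => lam ^ i / (i.factorial : ℝ)) (Real.exp lam) := by
    rw [Real.exp_eq_exp_ℝ]; exact NormedSpace.expSeries_div_hasSum_exp lam
  have hcb : ∀ k i, ‖c k i‖ ≤ lam ^ i / (i.factorial : ℝ) * (2 * M) := by
    intro k i
    simp only [c, norm_mul, norm_div, norm_pow, Real.norm_eq_abs, Nat.abs_cast, abs_of_nonneg hl]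
    refine mul_le_mul ?_ (hFb _) (abs_nonneg _) (by positivity)
    rw [div_le_div_iff₀ (by positivity) (by positivity)]
    have : (k.factorial : ℝ) * (i.factorial : ℝ) ≤ ((k + i).factorial : ℝ) := by
      exact_mod_cast Nat.le_of_dvd (Nat.factorial_pos _) (Nat.factorial_mul_factorial_dvd_factorial_add k i)
    have := mul_le_mul_of_nonneg_left this (pow_nonneg hl i)
    linarith
  have hsum : ∀ k, Summable (c k) := fun k =>
    Summable.of_norm_bounded (hexp.summable.mul_right _) (hcb k)
  let a : ℕ → ℝ := fun k => ∑' i, c k i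
  have hab : ∀ k, |a k| ≤ 2 * M * Real.exp lam := by
    intro k
    have := tsum_of_norm_bounded (hexp.mul_right (2 * M)) (hcb k)
    rw [Real.norm_eq_abs] at this
    linarith
  have hrec : ∀ k, a k = F k + lam / (k + 1) * a (k + 1) := by
    intro k
    simp only [a]
    rw [(hsum k).tsum_eq_zero_add, ← tsum_mul_left]
    congr 1
    · have : (k.factorial : ℝ) ≠ 0 := by positivity
      simp [c, this]
    · congr 1
      funext i
      simp only [c]
      rw [show k + 1 + i = k + (i + 1) by ring, Nat.factorial_succ k]
      have : (k : ℝ) + 1 ≠ 0 := by positivity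
      push_cast
      field_simp
      ring
  have ha0 : a 0 = 0 := by
    have h1 : a 0 = ∑' i, Real.exp lam * (poissonProb lam i * F i) := by
      simp only [a]
      congr 1
      funext i
      simp only [c, poissonProb, Real.exp_neg, Nat.factorial_zero, zero_add]
      have := Real.exp_pos lam
      field_simp
      simp
    rw [h1, tsum_mul_left]
    have : Po lam F = 0 := by
      rw [hF, Po_sub hl hf (fun k => le_rfl), Po_const, sub_self]
    change _ * Po lam F = 0
    rw [this, mul_zero]
  refine ⟨fun k => -(a (k + 1) / (k + 1)), fun k => ?_, fun k => ?_⟩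
  · rw [abs_neg, abs_div]
    have h1 : (1 : ℝ) ≤ |(k : ℝ) + 1| := by
      rw [abs_of_nonneg (by positivity)]
      have : (0 : ℝ) ≤ k := by positivity
      linarith
    exact (div_le_self (abs_nonneg _) h1).trans (hab _)
  · have h2 : (k : ℝ) * -(a (k - 1 + 1) / (((k - 1 : ℕ) : ℝ) + 1)) = - a k := by
      cases k with
      | zero => simp [ha0]
      | succ k =>
        simp only [Nat.add_sub_cancel]
        have : (k : ℝ) + 1 ≠ 0 := by positivity
        push_cast
        field_simp
    have h3 := hrec k
    simp only [h2]
    rw [h3]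
    simp only [hF]
    ring

/-- The two Poisson identities for the Stein solution. -/
lemma stein_ident1 {lam : ℝ} (hl : 0 ≤ lam) {f u : ℕ → ℝ} {M U : ℝ} (hf : ∀ k, |f k| ≤ M)
    (hu : ∀ k, |u k| ≤ U)
    (heq : ∀ k : ℕ, lam * u k - k * u (k - 1) = f k - Po lam f) :
    lam * Po lam (fun k => u k * (f (k + 1) - f k)) =
      - (Po lam (fun k => f k ^ 2) - Po lam f ^ 2) := by
  have hM : 0 ≤ M := (abs_nonneg _).trans (hf 0)
  have hU : 0 ≤ U := (abs_nonneg _).trans (hu 0)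
  have huf : ∀ k, |u (k - 1) * f k| ≤ U * M := fun k => by
    rw [abs_mul]; exact mul_le_mul (hu _) (hf _) (abs_nonneg _) hU
  have huf' : ∀ k, |u k * f k| ≤ U * M := fun k => by
    rw [abs_mul]; exact mul_le_mul (hu _) (hf _) (abs_nonneg _) hU
  have huf1 : ∀ k, |u k * f (k + 1)| ≤ U * M := fun k => by
    rw [abs_mul]; exact mul_le_mul (hu _) (hf _) (abs_nonneg _) hU
  have hff : ∀ k, |f k ^ 2| ≤ M * M := fun k => by
    rw [sq, abs_mul]; exact mul_le_mul (hf _) (hf _) (abs_nonneg _) hM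
  have h1 := hasSum_shift hl huf
  simp only [Nat.add_sub_cancel] at h1
  have h2 := (summable_pp_mul hl huf').hasSum.mul_left lam
  have h3 := (summable_pp_mul hl hff).hasSum
  have h4 := ((summable_pp_mul hl hf).hasSum).mul_left (Po lam f)
  have h5 := (h2.sub h1).unique ((hasSum_congr_aux fun k => by
    have := congrArg (fun x => poissonProb lam k * (x * f k)) (heq k)
    linarith).mp (h3.sub h4))
  have h6 : Po lam (fun k => u k * (f (k + 1) - f k)) =
      Po lam (fun k => u k * f (k + 1)) - Po lam (fun k => u k * f k) := by
    rw [← Po_sub hl huf1 huf']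
    congr 1; funext k; ring
  rw [h6]
  change lam * Po lam (fun k => u k * f k) - _ = Po lam (fun k => f k ^ 2) - Po lam f * Po lam f at h5
  linarith

lemma stein_ident2 {lam : ℝ} (hl : 0 ≤ lam) {f u : ℕ → ℝ} {M U : ℝ} (hf : ∀ k, |f k| ≤ M)
    (hu : ∀ k, |u k| ≤ U)
    (heq : ∀ k : ℕ, lam * u k - k * u (k - 1) = f k - Po lam f) :
    Po lam u = - Po lam (fun k => f (k + 1) - f k) := by
  have h1 := hasSum_shift hl hu
  have h2 := (summable_pp_mul hl (f := fun k => u (k + 1)) (fun k => hu _)).hasSum.mul_left lam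
  have h3 := (summable_pp_mul hl hu).hasSum
  have hb : ∀ k, |f (k + 1) - Po lam f| ≤ M + |Po lam f| := fun k => by
    have := abs_sub (f (k + 1)) (Po lam f)
    have := hf (k + 1)
    linarith
  have h4 := (summable_pp_mul hl hb).hasSum
  have h5 := ((h2.sub h1).sub h3).unique ((hasSum_congr_aux fun k => by
    have := congrArg (fun x => poissonProb lam k * x) (heq (k + 1))
    simp only [Nat.add_sub_cancel] at this
    push_cast at this
    linarith).mp h4)
  have h6 : Po lam (fun k => f (k + 1) - Po lam f) = Po lam (fun k => f (k + 1)) - Po lam f := by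
    rw [Po_sub hl (f := fun k => f (k + 1)) (fun k => hf _) (fun k => le_rfl), Po_const]
  have h7 : Po lam (fun k => f (k + 1) - f k) = Po lam (fun k => f (k + 1)) - Po lam f :=
    Po_sub hl (f := fun k => f (k + 1)) (fun k => hf _) hf
  change lam * Po lam (fun k => u (k + 1)) - lam * Po lam (fun k => u (k + 1)) - Po lam u =
    Po lam (fun k => f (k + 1) - Po lam f) at h5
  linarith

lemma Po_diff {lam : ℝ} (hl : 0 ≤ lam) {f : ℕ → ℝ} {M : ℝ} (hf : ∀ k, |f k| ≤ M) :
    lam * Po lam (fun k => f (k + 1) - f k) = Po lam (fun k => ((k : ℝ) - lam) * f k) := by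
  have h1 := hasSum_shift hl hf
  have h2 := (summable_pp_mul hl hf).hasSum.mul_left lam
  have h7 : Po lam (fun k => f (k + 1) - f k) = Po lam (fun k => f (k + 1)) - Po lam f :=
    Po_sub hl (f := fun k => f (k + 1)) (fun k => hf _) hf
  have h3 := (h1.sub h2).tsum_eq
  have h4 : Po lam (fun k => ((k : ℝ) - lam) * f k) =
      lam * Po lam (fun k => f (k + 1)) - lam * Po lam f := by
    unfold Po at h3 ⊢
    rw [← h3]
    congr 1; funext k; ring
  rw [h4, h7]
  ring

end PoissonStein

section GraphPart

variable {n : ℕ}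

/-- Edges at `v`. -/
def edgesAt (n : ℕ) (v : Fin n) : Finset (EdgeIdx n) :=
  Finset.univ.filter fun e => v ∈ (e : Sym2 (Fin n))

/-- Endpoints of `e`. -/
def ends (e : EdgeIdx n) : Finset (Fin n) :=
  Finset.univ.filter fun v => v ∈ (e : Sym2 (Fin n))

lemma mem_edgesAt {v : Fin n} {e : EdgeIdx n} :
    e ∈ edgesAt n v ↔ v ∈ (e : Sym2 (Fin n)) := by simp [edgesAt]

lemma mem_ends {v : Fin n} {e : EdgeIdx n} : v ∈ ends e ↔ v ∈ (e : Sym2 (Fin n)) := by simp [ends]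

lemma card_ends (e : EdgeIdx n) : (ends e).card = 2 := by
  obtain ⟨e, he⟩ := e
  induction e using Sym2.ind with
  | _ a b =>
    have hab : a ≠ b := by simpa using he
    have : ends (⟨s(a, b), he⟩ : EdgeIdx n) = {a, b} := by
      ext v; simp [ends]
    rw [this, Finset.card_pair hab]

lemma card_edgesAt (v : Fin n) : (edgesAt n v).card = n - 1 := by
  have : (edgesAt n v).card = ((Finset.univ : Finset (Fin n)).erase v).card := by
    symm
    refine Finset.card_bij (fun w hw => (⟨s(v, w), by
      simpa [eq_comm] using hw⟩ : EdgeIdx n)) ?_ ?_ ?_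
    · intro w hw
      simp [edgesAt]
    · intro a ha b hb h
      have h' : a = b ∨ v = b ∧ a = v := by simpa using h
      rcases h' with h' | ⟨h1, h2⟩
      · exact h'
      · exact h2.trans h1
    · rintro ⟨e, he⟩ hv
      have hv' : v ∈ e := by simpa [edgesAt] using hv
      obtain ⟨w, rfl⟩ := Sym2.mem_iff_exists.1 hv'
      refine ⟨w, ?_, rfl⟩
      simpa [eq_comm] using he
  rw [this, Finset.card_erase_of_mem (Finset.mem_univ _), Finset.card_univ, Fintype.card_fin]

lemma edge_unique {v w : Fin n} (hvw : v ≠ w) {e e' : EdgeIdx n} (h1 : v ∈ (e : Sym2 (Fin n)))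
    (h2 : w ∈ (e : Sym2 (Fin n))) (h1' : v ∈ (e' : Sym2 (Fin n)))
    (h2' : w ∈ (e' : Sym2 (Fin n))) : e = e' := by
  apply Subtype.ext
  rw [(Sym2.mem_and_mem_iff hvw).1 ⟨h1, h2⟩, (Sym2.mem_and_mem_iff hvw).1 ⟨h1', h2'⟩]

lemma sum_ends_edges {R : Type*} [AddCommMonoid R] (f : Fin n → EdgeIdx n → R) :
    ∑ e, ∑ v ∈ ends e, f v e = ∑ v, ∑ e ∈ edgesAt n v, f v e := by
  simp only [ends, edgesAt, Finset.sum_filter]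
  exact Finset.sum_comm

lemma degree_eq (S : EdgeIdx n → Bool) (v : Fin n) :
    degree n S v = ((edgesAt n v).filter fun e => S e = true).card := by
  unfold degree edgesAt
  rw [Finset.filter_filter]
  congr 1
  ext e; simp [and_comm]

lemma degree_update_notMem (S : EdgeIdx n → Bool) {v : Fin n} {e : EdgeIdx n}
    (h : v ∉ (e : Sym2 (Fin n))) (b : Bool) :
    degree n (Function.update S e b) v = degree n S v := by
  rw [degree_eq, degree_eq]
  congr 1
  apply Finset.filter_congr
  intro f hf
  have : f ≠ e := by rintro rfl; exact h (mem_edgesAt.1 hf)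
  rw [Function.update_of_ne this]

lemma degree_update_true (S : EdgeIdx n → Bool) {v : Fin n} {e : EdgeIdx n}
    (h : v ∈ (e : Sym2 (Fin n))) :
    degree n (Function.update S e true) v = degree n (Function.update S e false) v + 1 := by
  rw [degree_eq, degree_eq]
  have : (edgesAt n v).filter (fun f => Function.update S e true f = true) =
      insert e ((edgesAt n v).filter (fun f => Function.update S e false f = true)) := by
    ext f
    simp only [Finset.mem_filter, Finset.mem_insert]
    by_cases hf : f = e
    · subst hf; simp [mem_edgesAt, h]
    · simp [hf]
  rw [this, Finset.card_insert_of_notMem (by simp)]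

/-- degree of `v` without `e`. -/
def dm (e : EdgeIdx n) (v : Fin n) (S : EdgeIdx n → Bool) : ℕ :=
  degree n (Function.update S e false) v

variable {E : Type*} [NormedAddCommGroup E] [NormedSpace ℝ E]

/-- Exact one-vertex formula. -/
lemma vertex_formula (p lam : ℝ) (hn : 0 < n) (hlam : lam = n * p) (u : ℕ → ℝ)
    (v : Fin n) (F : (EdgeIdx n → Bool) → E) :
    Ex p (fun S => (lam * u (degree n S v) - degree n S v * u (degree n S v - 1)) • F S) =
      p • Ex p (fun S => u (degree n S v) • F S) +
      ∑ e ∈ edgesAt n v, (p ^ 2 • Ex p (fun S => (u (dm e v S + 1) - u (dm e v S)) •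
          F (Function.update S e true)) -
        (p * (1 - p)) • Ex p (fun S => u (dm e v S) • Dd e F S)) := by
  have h1 : ∀ e ∈ edgesAt n v, Ex p (fun S => (if S e = true then u (degree n S v - 1) else 0) • F S)
      = p • Ex p (fun S => u (dm e v S) • F (Function.update S e true)) := by
    intro e he
    rw [← Ex_av p e, ← Ex_smul]
    congr 1
    funext S
    simp [av, dm, degree_update_true S (mem_edgesAt.1 he)]
  have h2 : ∀ e ∈ edgesAt n v, Ex p (fun S => u (degree n S v) • F S)
      = Ex p (fun S => (1 - p) • u (dm e v S) • F (Function.update S e false) +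
          p • u (dm e v S + 1) • F (Function.update S e true)) := by
    intro e he
    rw [← Ex_av p e]
    congr 1
    funext S
    simp [av, dm, degree_update_true S (mem_edgesAt.1 he)]
  have h3 : Ex p (fun S => ((degree n S v : ℝ) * u (degree n S v - 1)) • F S) =
      ∑ e ∈ edgesAt n v, p • Ex p (fun S => u (dm e v S) • F (Function.update S e true)) := by
    rw [← Finset.sum_congr rfl h1, ← Ex_sum]
    congr 1
    funext S
    rw [← Finset.sum_smul, ← Finset.sum_filter, Finset.sum_const, nsmul_eq_mul, degree_eq]
  have hcard : (n : ℝ) = 1 + ((edgesAt n v).card : ℝ) := by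
    rw [card_edgesAt, Nat.cast_sub hn]; simp
  have h4 : Ex p (fun S => (lam * u (degree n S v)) • F S) =
      p • Ex p (fun S => u (degree n S v) • F S) +
        ∑ e ∈ edgesAt n v, p • Ex p (fun S => u (degree n S v) • F S) := by
    simp only [mul_smul]
    rw [Ex_smul, Finset.sum_const, hlam, hcard, ← Nat.cast_smul_eq_nsmul ℝ, smul_smul, ← add_smul]
    congr 1
    ring
  simp only [sub_smul]
  rw [Ex_sub, h3, h4, add_sub_assoc, ← Finset.sum_sub_distrib]
  congr 1
  refine Finset.sum_congr rfl fun e he => ?_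
  rw [h2 e he]
  simp only [← Ex_smul, ← Ex_sub]
  congr 1
  funext S
  simp only [Dd]
  module

lemma vertex_bound {p lam U B : ℝ} (h0 : 0 ≤ p) (h1 : p ≤ 1) (hn : 0 < n) (hlam : lam = n * p)
    {u : ℕ → ℝ} (hu : ∀ k, |u k| ≤ U)
    (v : Fin n) {F : (EdgeIdx n → Bool) → E} (hF : ∀ S, ‖F S‖ ≤ B) :
    ‖Ex p (fun S => (lam * u (degree n S v) - degree n S v * u (degree n S v - 1)) • F S) +
      (p * (1 - p)) • ∑ e ∈ edgesAt n v, Ex p (fun S => u (dm e v S) • Dd e F S)‖ ≤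
      p * (1 + 2 * lam) * U * B := by
  have hU : 0 ≤ U := (abs_nonneg _).trans (hu 0)
  have hB : 0 ≤ B := (norm_nonneg _).trans (hF (fun _ => false))
  rw [vertex_formula p lam hn hlam u v F, Finset.sum_sub_distrib, ← Finset.smul_sum,
    ← Finset.smul_sum, add_assoc, sub_add_cancel]
  have b1 : ‖p • Ex p (fun S => u (degree n S v) • F S)‖ ≤ p * (U * B) := by
    rw [norm_smul, Real.norm_of_nonneg h0]
    refine mul_le_mul_of_nonneg_left (norm_Ex_le_of_le h0 h1 fun S => ?_) h0
    rw [norm_smul]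
    exact mul_le_mul (hu _) (hF _) (norm_nonneg _) hU
  have b2 : ‖p ^ 2 • ∑ e ∈ edgesAt n v, Ex p (fun S => (u (dm e v S + 1) - u (dm e v S)) •
          F (Function.update S e true))‖ ≤ p ^ 2 * (n * (2 * U * B)) := by
    rw [norm_smul, Real.norm_of_nonneg (by positivity)]
    refine mul_le_mul_of_nonneg_left ?_ (by positivity)
    calc _ ≤ ∑ e ∈ edgesAt n v, (2 * U * B) := norm_sum_le_of_le _ fun e _ =>
          norm_Ex_le_of_le h0 h1 fun S => by
            rw [norm_smul]
            refine mul_le_mul ?_ (hF _) (norm_nonneg _) (by positivity)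
            refine (norm_sub_le _ _).trans ?_
            have := hu (dm e v S + 1)
            have := hu (dm e v S)
            simp only [Real.norm_eq_abs]
            linarith
      _ ≤ _ := by
        rw [Finset.sum_const, nsmul_eq_mul, card_edgesAt]
        refine mul_le_mul_of_nonneg_right ?_ (by positivity)
        exact_mod_cast Nat.sub_le _ _
  refine (norm_add_le _ _).trans ((add_le_add b1 b2).trans (le_of_eq ?_))
  rw [hlam]; ring

/-- Asymptotic independence constant. -/
def kap (lam : ℝ) : ℝ := (3 + 2 * lam) * (2 * Real.exp lam) + 2

lemma vertex_poisson {p lam M B : ℝ} (h0 : 0 ≤ p) (h1 : p ≤ 1) (hn : 0 < n) (hlam : lam = n * p)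
    {f : ℕ → ℝ} (hf : ∀ k, |f k| ≤ M)
    (v : Fin n) {F : (EdgeIdx n → Bool) → ℝ} (hF : ∀ S, |F S| ≤ B)
    (e₀ : EdgeIdx n) (hD : ∀ e : EdgeIdx n, v ∈ (e : Sym2 (Fin n)) → e ≠ e₀ → ∀ S, Dd e F S = 0) :
    |Ex p (fun S => f (degree n S v) * F S) - Po lam f * Ex p F| ≤
      p * ((3 + 2 * lam) * (2 * Real.exp lam)) * M * B := by
  have hl : 0 ≤ lam := by rw [hlam]; positivity
  have hM : 0 ≤ M := (abs_nonneg _).trans (hf 0)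
  have hB : 0 ≤ B := (abs_nonneg _).trans (hF (fun _ => false))
  obtain ⟨u, hu, heq⟩ := stein_solution hl hf
  have h := vertex_bound h0 h1 hn hlam hu v (F := F) hF
  set U := 2 * M * Real.exp lam with hUdef
  have hU : 0 ≤ U := by positivity
  have e1 : Ex p (fun S => (lam * u (degree n S v) - degree n S v * u (degree n S v - 1)) • F S) =
      Ex p (fun S => f (degree n S v) * F S) - Po lam f * Ex p F := by
    rw [← Ex_mul_left, ← Ex_sub]
    congr 1
    funext S
    rw [heq, smul_eq_mul, sub_mul]
  rw [e1] at h
  have b : ‖(p * (1 - p)) • ∑ e ∈ edgesAt n v, Ex p (fun S => u (dm e v S) • Dd e F S)‖ ≤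
      p * (U * (2 * B)) := by
    have hs : ‖∑ e ∈ edgesAt n v, Ex p (fun S => u (dm e v S) • Dd e F S)‖ ≤ U * (2 * B) := by
      have : ∑ e ∈ edgesAt n v, Ex p (fun S => u (dm e v S) • Dd e F S) =
          if e₀ ∈ edgesAt n v then Ex p (fun S => u (dm e₀ v S) • Dd e₀ F S) else 0 := by
        rw [← Finset.sum_ite_eq' (edgesAt n v) e₀
          (fun e => Ex p (fun S => u (dm e v S) • Dd e F S))]
        refine Finset.sum_congr rfl fun e he => ?_
        split_ifs with hh
        · rfl
        · simp only [hD e (mem_edgesAt.1 he) hh, smul_zero]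
          exact Ex_const p (0 : ℝ)
      rw [this]
      split_ifs
      · refine norm_Ex_le_of_le h0 h1 fun S => ?_
        rw [norm_smul]
        refine mul_le_mul (hu _) ?_ (norm_nonneg _) hU
        refine (norm_sub_le _ _).trans ?_
        have := hF (Function.update S e₀ true)
        have := hF (Function.update S e₀ false)
        simp only [Real.norm_eq_abs]
        linarith
      · rw [norm_zero]; positivity
    rw [norm_smul, Real.norm_of_nonneg (mul_nonneg h0 (by linarith))]
    refine mul_le_mul ?_ hs (norm_nonneg _) h0
    nlinarith
  have := norm_sub_le_of_le h b
  rw [add_sub_cancel_right, Real.norm_eq_abs] at this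
  refine this.trans (le_of_eq ?_)
  rw [hUdef]; ring

lemma Ex_remove {p B : ℝ} (h0 : 0 ≤ p) (h1 : p ≤ 1) (e : EdgeIdx n)
    {G : (EdgeIdx n → Bool) → ℝ} (hG : ∀ S, |G S| ≤ B) :
    |Ex p (fun S => G (Function.update S e false)) - Ex p G| ≤ p * (2 * B) := by
  rw [← Ex_av p e G, ← Ex_sub, ← Real.norm_eq_abs]
  refine norm_Ex_le_of_le h0 h1 fun S => ?_
  have : G (Function.update S e false) - av p e G S =
      p * (G (Function.update S e false) - G (Function.update S e true)) := by
    simp only [av, smul_eq_mul]; ring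
  rw [this, norm_mul, Real.norm_of_nonneg h0]
  refine mul_le_mul_of_nonneg_left ((norm_sub_le _ _).trans ?_) h0
  have := hG (Function.update S e true)
  have := hG (Function.update S e false)
  simp only [Real.norm_eq_abs]
  linarith

end GraphPart

section MainEstimates

variable {n : ℕ}

/-- The centered linear statistic. -/
def Wt (n : ℕ) (lam : ℝ) (g : ℕ → ℝ) (S : EdgeIdx n → Bool) : ℝ :=
  ∑ v, (g (degree n S v) - Po lam g)

/-- Explicit form of the discrete derivative of `Wt`. -/
def DW (g : ℕ → ℝ) (e : EdgeIdx n) (S : EdgeIdx n → Bool) : ℝ :=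
  ∑ w ∈ ends e, (g (dm e w S + 1) - g (dm e w S))

lemma Dd_Wt (lam : ℝ) (g : ℕ → ℝ) (e : EdgeIdx n) (S : EdgeIdx n → Bool) :
    Dd e (Wt n lam g) S = DW g e S := by
  simp only [Dd, Wt, DW, ← Finset.sum_sub_distrib]
  symm
  refine Finset.sum_subset_zero_on_sdiff (Finset.subset_univ _) ?_ ?_
  · intro v hv
    have hv' : v ∉ (e : Sym2 (Fin n)) := by simpa [mem_ends] using hv
    rw [degree_update_notMem S hv', degree_update_notMem S hv']
    ring
  · intro v hv
    rw [degree_update_true S (mem_ends.1 hv)]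
    simp only [dm]
    ring

lemma abs_DW_le {g : ℕ → ℝ} {M : ℝ} (hg : ∀ k, |g k| ≤ M) (e : EdgeIdx n)
    (S : EdgeIdx n → Bool) : |DW g e S| ≤ 4 * M := by
  calc |DW g e S| ≤ ∑ w ∈ ends e, (2 * M) := by
        refine (Finset.abs_sum_le_sum_abs _ _).trans (Finset.sum_le_sum fun w _ => ?_)
        have h1 := abs_sub (g (dm e w S + 1)) (g (dm e w S))
        have h2 := hg (dm e w S + 1)
        have h3 := hg (dm e w S)
        linarith
    _ = 4 * M := by rw [Finset.sum_const, card_ends, nsmul_eq_mul]; push_cast; ring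

/-- The carre-du-champ type statistic. -/
def Tt (n : ℕ) (p : ℝ) (g u : ℕ → ℝ) (S : EdgeIdx n → Bool) : ℝ :=
  (p * (1 - p) / n) * ∑ v, ∑ e ∈ edgesAt n v, u (dm e v S) * DW g e S

lemma norm_exp_sub_aux (x : ℝ) :
    ‖Complex.exp (Complex.I * x) - 1 - Complex.I * x‖ ≤ 3 * x ^ 2 := by
  by_cases hx : |x| ≤ 1
  · have h := Complex.norm_exp_sub_one_sub_id_le (x := Complex.I * x) (by simpa using hx)
    rw [norm_mul, Complex.norm_I, one_mul, Complex.norm_real, Real.norm_eq_abs, sq_abs] at h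
    nlinarith [sq_nonneg x]
  · push Not at hx
    have h1 : ‖Complex.exp (Complex.I * x)‖ = 1 := by
      rw [mul_comm]; exact Complex.norm_exp_ofReal_mul_I x
    have h2 : ‖Complex.I * (x : ℂ)‖ = |x| := by simp
    have h3 := norm_sub_le (Complex.exp (Complex.I * x) - 1) (Complex.I * x)
    have h4 := norm_sub_le (Complex.exp (Complex.I * x)) 1
    rw [norm_one] at h4
    have h5 := sq_abs x
    nlinarith

/-- The exponential test function. -/
def Fx (n : ℕ) (lam : ℝ) (g : ℕ → ℝ) (r : ℝ) (S : EdgeIdx n → Bool) : ℂ :=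
  Complex.exp (Complex.I * ((r * Wt n lam g S : ℝ) : ℂ))

lemma norm_Fx (lam : ℝ) (g : ℕ → ℝ) (r : ℝ) (S : EdgeIdx n → Bool) :
    ‖Fx n lam g r S‖ = 1 := by
  unfold Fx; rw [mul_comm]; exact Complex.norm_exp_ofReal_mul_I _

lemma Dd_Fx (lam : ℝ) (g : ℕ → ℝ) (r : ℝ) (e : EdgeIdx n) (S : EdgeIdx n → Bool) :
    ‖Dd e (Fx n lam g r) S - (Complex.I * r) * (DW g e S * Fx n lam g r S)‖ ≤
      3 * (r * DW g e S) ^ 2 := by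
  have hW := Dd_Wt lam g e S
  unfold Dd at hW
  set W1 := Wt n lam g (Function.update S e true) with hW1
  set W0 := Wt n lam g (Function.update S e false) with hW0
  set x := DW g e S with hx
  rcases update_cases S e with ⟨_, h⟩ | ⟨_, h⟩
  · have hF1 : Fx n lam g r (Function.update S e true) =
        Fx n lam g r S * Complex.exp (Complex.I * ((r * x : ℝ) : ℂ)) := by
      unfold Fx
      rw [← Complex.exp_add, ← hW1, ← hW]
      congr 1
      rw [← h, ← hW0]
      push_cast; ring
    have : Dd e (Fx n lam g r) S - (Complex.I * r) * (x * Fx n lam g r S) =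
        Fx n lam g r S * (Complex.exp (Complex.I * ((r * x : ℝ) : ℂ)) - 1 -
          Complex.I * ((r * x : ℝ) : ℂ)) := by
      unfold Dd
      rw [hF1, h]; push_cast; ring
    rw [this, norm_mul, norm_Fx, one_mul]
    exact norm_exp_sub_aux _
  · have hF1 : Fx n lam g r (Function.update S e false) =
        Fx n lam g r S * Complex.exp (Complex.I * ((-(r * x) : ℝ) : ℂ)) := by
      unfold Fx
      rw [← Complex.exp_add, ← hW0, ← hW]
      congr 1
      rw [← h, ← hW1]
      push_cast; ring
    have : Dd e (Fx n lam g r) S - (Complex.I * r) * (x * Fx n lam g r S) =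
        - (Fx n lam g r S * (Complex.exp (Complex.I * ((-(r * x) : ℝ) : ℂ)) - 1 -
          Complex.I * ((-(r * x) : ℝ) : ℂ))) := by
      unfold Dd
      rw [hF1, h]; push_cast; ring
    rw [this, norm_neg, norm_mul, norm_Fx, one_mul]
    refine (norm_exp_sub_aux _).trans (le_of_eq ?_)
    ring

lemma stein_W {p lam U M r : ℝ} (h0 : 0 ≤ p) (h1 : p ≤ 1) (hn : 0 < n) (hlam : lam = n * p)
    {g u : ℕ → ℝ} (hg : ∀ k, |g k| ≤ M) (hu : ∀ k, |u k| ≤ U)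
    (heq : ∀ k : ℕ, lam * u k - k * u (k - 1) = g k - Po lam g) :
    ‖Ex p (fun S => Wt n lam g S • Fx n lam g r S) +
      (Complex.I * r * n) * Ex p (fun S => Tt n p g u S • Fx n lam g r S)‖ ≤
      lam * (1 + 2 * lam) * U + lam * n * (U * (3 * (4 * M * r) ^ 2)) := by
  have hU : 0 ≤ U := (abs_nonneg _).trans (hu 0)
  have hM : 0 ≤ M := (abs_nonneg _).trans (hg 0)
  have hn' : (n : ℝ) ≠ 0 := by positivity
  set F := Fx n lam g r with hF
  have hpp : 0 ≤ p * (1 - p) := mul_nonneg h0 (by linarith)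
  have e1 : Ex p (fun S => Wt n lam g S • F S) =
      ∑ v, Ex p (fun S => (lam * u (degree n S v) - degree n S v * u (degree n S v - 1)) • F S) := by
    rw [← Ex_sum]
    congr 1
    funext S
    simp only [heq, Wt, Finset.sum_smul]
  have b1 : ‖Ex p (fun S => Wt n lam g S • F S) +
      (p * (1 - p)) • ∑ v, ∑ e ∈ edgesAt n v, Ex p (fun S => u (dm e v S) • Dd e F S)‖ ≤
      lam * (1 + 2 * lam) * U := by
    rw [e1, Finset.smul_sum, ← Finset.sum_add_distrib]
    calc _ ≤ ∑ v : Fin n, p * (1 + 2 * lam) * U * 1 := norm_sum_le_of_le _ fun v _ =>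
          vertex_bound h0 h1 hn hlam hu v (fun S => (norm_Fx lam g r S).le)
      _ = _ := by
          rw [Finset.sum_const, Finset.card_univ, Fintype.card_fin, nsmul_eq_mul]
          rw [hlam]
          ring
  have e2 : (Complex.I * r * n) * Ex p (fun S => Tt n p g u S • F S) =
      (p * (1 - p)) • ∑ v, ∑ e ∈ edgesAt n v,
        Ex p (fun S => u (dm e v S) • ((Complex.I * r) * (DW g e S * F S))) := by
    simp only [← Ex_sum, ← Ex_smul, ← Ex_cmul_left]
    congr 1
    funext S
    simp only [Tt, Complex.real_smul]
    push_cast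
    have hn'' : (n : ℂ) ≠ 0 := by exact_mod_cast hn'
    field_simp
    simp only [Finset.sum_mul, Finset.mul_sum]
    refine Finset.sum_congr rfl fun v _ => Finset.sum_congr rfl fun e _ => ?_
    ring
  have b2 : ‖(p * (1 - p)) • ∑ v, ∑ e ∈ edgesAt n v, Ex p (fun S => u (dm e v S) • Dd e F S) -
      (Complex.I * r * n) * Ex p (fun S => Tt n p g u S • F S)‖ ≤
      lam * n * (U * (3 * (4 * M * r) ^ 2)) := by
    rw [e2, ← smul_sub, ← Finset.sum_sub_distrib, norm_smul, Real.norm_of_nonneg hpp]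
    simp only [← Finset.sum_sub_distrib]
    have hs : ‖∑ v, ∑ e ∈ edgesAt n v, (Ex p (fun S => u (dm e v S) • Dd e F S) -
        Ex p (fun S => u (dm e v S) • ((Complex.I * r) * (DW g e S * F S))))‖ ≤
        n * (n * (U * (3 * (4 * M * r) ^ 2))) := by
      calc _ ≤ ∑ v : Fin n, (n * (U * (3 * (4 * M * r) ^ 2)) : ℝ) := norm_sum_le_of_le _ fun v _ => by
            calc _ ≤ ∑ e ∈ edgesAt n v, (U * (3 * (4 * M * r) ^ 2)) :=
                  norm_sum_le_of_le _ fun e _ => by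
                    rw [← Ex_sub]
                    refine norm_Ex_le_of_le h0 h1 fun S => ?_
                    rw [← smul_sub, norm_smul]
                    refine mul_le_mul (hu _) ((Dd_Fx lam g r e S).trans ?_) (norm_nonneg _) hU
                    have := abs_DW_le hg e S
                    have h2 : DW g e S ^ 2 ≤ (4 * M) ^ 2 := sq_le_sq' (abs_le.1 this).1 (abs_le.1 this).2
                    have := mul_le_mul_of_nonneg_left h2 (sq_nonneg r)
                    nlinarith
              _ ≤ _ := by
                rw [Finset.sum_const, nsmul_eq_mul, card_edgesAt]
                refine mul_le_mul_of_nonneg_right ?_ (by positivity)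
                exact_mod_cast Nat.sub_le _ _
        _ = _ := by rw [Finset.sum_const, Finset.card_univ, Fintype.card_fin, nsmul_eq_mul]
    calc _ ≤ p * (n * (n * (U * (3 * (4 * M * r) ^ 2)))) :=
          mul_le_mul (by nlinarith) hs (norm_nonneg _) h0
      _ = _ := by rw [hlam]; ring
  refine le_trans (le_of_eq ?_) (norm_sub_le_of_le b1 b2)
  congr 1
  ring

lemma dm_update {e f : EdgeIdx n} {v : Fin n} (hef : f ≠ e) (hv : v ∉ (f : Sym2 (Fin n)))
    (S : EdgeIdx n → Bool) (b : Bool) : dm e v (Function.update S f b) = dm e v S := by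
  unfold dm
  rw [Function.update_comm hef, degree_update_notMem _ hv]

lemma Dd_Tt_le {p U M : ℝ} (h0 : 0 ≤ p) (h1 : p ≤ 1) (hn : 0 < n)
    {g u : ℕ → ℝ} (hg : ∀ k, |g k| ≤ M) (hu : ∀ k, |u k| ≤ U) (f : EdgeIdx n)
    (S : EdgeIdx n → Bool) : |Dd f (Tt n p g u) S| ≤ 32 * p * M * U := by
  have hU : 0 ≤ U := (abs_nonneg _).trans (hu 0)
  have hM : 0 ≤ M := (abs_nonneg _).trans (hg 0)
  have hpp : 0 ≤ p * (1 - p) := mul_nonneg h0 (by linarith)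
  have hn' : (0 : ℝ) < n := by positivity
  let t : Fin n → EdgeIdx n → (EdgeIdx n → Bool) → ℝ := fun v e S => u (dm e v S) * DW g e S
  have ht : ∀ v e S, |t v e S| ≤ U * (4 * M) := fun v e S => by
    simp only [t, abs_mul]
    exact mul_le_mul (hu _) (abs_DW_le hg e S) (abs_nonneg _) hU
  have e1 : Dd f (Tt n p g u) S = (p * (1 - p) / n) * ∑ e, ∑ v ∈ ends e, Dd f (t v e) S := by
    simp only [Dd, Tt, Finset.sum_sub_distrib, sum_ends_edges, t]
    ring
  have hterm : ∀ (e : EdgeIdx n), ∀ v ∈ ends e, |Dd f (t v e) S| ≤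
      ∑ x ∈ ends f, (if e ∈ edgesAt n x then 8 * M * U else 0) := by
    intro e v hv
    by_cases hx : ∃ x ∈ ends f, e ∈ edgesAt n x
    · obtain ⟨x, hx, hxe⟩ := hx
      refine le_trans ?_ (Finset.single_le_sum
        (f := fun x => if e ∈ edgesAt n x then 8 * M * U else 0) (fun y _ => ?_) hx)
      · simp only [hxe, if_true]
        refine (abs_sub _ _).trans ?_
        have := ht v e (Function.update S f true)
        have := ht v e (Function.update S f false)
        linarith
      · split_ifs <;> positivity
    · push Not at hx
      have hd : ∀ w ∈ ends e, w ∉ (f : Sym2 (Fin n)) := fun w hw hwf =>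
        hx w (mem_ends.2 hwf) (mem_edgesAt.2 (mem_ends.1 hw))
      have hfe : f ≠ e := by
        rintro rfl
        exact hd v hv (mem_ends.1 hv)
      have hz : Dd f (t v e) S = 0 := by
        have hh : ∀ b, t v e (Function.update S f b) = t v e S := by
          intro b
          simp only [t, DW]
          rw [dm_update hfe (hd v hv)]
          congr 1
          refine Finset.sum_congr rfl fun w hw => ?_
          rw [dm_update hfe (hd w hw)]
        simp only [Dd, hh, sub_self]
      rw [hz, abs_zero]
      refine Finset.sum_nonneg fun y _ => ?_
      split_ifs <;> positivity
  have hsum : |∑ e, ∑ v ∈ ends e, Dd f (t v e) S| ≤ 32 * n * M * U := by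
    calc _ ≤ ∑ e, ∑ v ∈ ends e, |Dd f (t v e) S| :=
          (Finset.abs_sum_le_sum_abs _ _).trans
            (Finset.sum_le_sum fun e _ => Finset.abs_sum_le_sum_abs _ _)
      _ ≤ ∑ e, ∑ v ∈ ends e, ∑ x ∈ ends f, (if e ∈ edgesAt n x then 8 * M * U else 0) :=
          Finset.sum_le_sum fun e _ => Finset.sum_le_sum fun v hv => hterm e v hv
      _ = ∑ e, ∑ x ∈ ends f, (if e ∈ edgesAt n x then 16 * M * U else 0) := by
          refine Finset.sum_congr rfl fun e _ => ?_
          rw [Finset.sum_const, card_ends, Finset.smul_sum]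
          refine Finset.sum_congr rfl fun x _ => ?_
          split_ifs
          · rw [nsmul_eq_mul]; push_cast; ring
          · simp
      _ = ∑ x ∈ ends f, ∑ e ∈ edgesAt n x, 16 * M * U := by
          rw [Finset.sum_comm]
          refine Finset.sum_congr rfl fun x _ => ?_
          rw [← Finset.sum_filter]
          congr 1
          ext e; simp
      _ ≤ ∑ x ∈ ends f, (n : ℝ) * (16 * M * U) := Finset.sum_le_sum fun x _ => by
          rw [Finset.sum_const, nsmul_eq_mul, card_edgesAt]
          refine mul_le_mul_of_nonneg_right ?_ (by positivity)
          exact_mod_cast Nat.sub_le _ _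
      _ = _ := by rw [Finset.sum_const, card_ends, nsmul_eq_mul]; push_cast; ring
  rw [e1, abs_mul, abs_of_nonneg (by positivity)]
  calc _ ≤ (p / n) * (32 * n * M * U) := by
        refine mul_le_mul ?_ hsum (abs_nonneg _) (by positivity)
        gcongr
        nlinarith
    _ = _ := by field_simp

lemma card_edgeIdx_le : (Fintype.card (EdgeIdx n) : ℝ) ≤ (n : ℝ) * n := by
  have h := sum_ends_edges (n := n) (fun _ _ => (1 : ℕ))
  simp only [Finset.sum_const, card_ends, card_edgesAt, smul_eq_mul, mul_one,
    Finset.card_univ, Fintype.card_fin] at h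
  have : Fintype.card (EdgeIdx n) ≤ n * n := by
    have : n * (n - 1) ≤ n * n := Nat.mul_le_mul_left _ (Nat.sub_le _ _)
    omega
  exact_mod_cast this

lemma var_Tt {p lam U M : ℝ} (h0 : 0 ≤ p) (h1 : p ≤ 1) (hn : 0 < n) (hlam : lam = n * p)
    {g u : ℕ → ℝ} (hg : ∀ k, |g k| ≤ M) (hu : ∀ k, |u k| ≤ U) :
    Ex p (fun S => Tt n p g u S ^ 2) - (Ex p (Tt n p g u)) ^ 2 ≤
      lam ^ 3 * (32 * M * U) ^ 2 / n := by
  have hn' : (0 : ℝ) < n := by positivity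
  refine (efron_stein h0 h1 _).trans ?_
  have hb : ∑ e, Ex p (fun S => Dd e (Tt n p g u) S ^ 2) ≤ (n * n) * (32 * p * M * U) ^ 2 := by
    calc _ ≤ ∑ e : EdgeIdx n, (32 * p * M * U) ^ 2 := Finset.sum_le_sum fun e _ => by
          refine (Ex_mono h0 h1 (G := fun _ => (32 * p * M * U) ^ 2) fun S => ?_).trans_eq
            (Ex_const p _)
          have := Dd_Tt_le h0 h1 hn hg hu e S
          exact sq_le_sq' (abs_le.1 this).1 (abs_le.1 this).2
      _ ≤ _ := by
          rw [Finset.sum_const, nsmul_eq_mul, Finset.card_univ]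
          exact mul_le_mul_of_nonneg_right card_edgeIdx_le (by positivity)
  have hnn : 0 ≤ ∑ e, Ex p (fun S => Dd e (Tt n p g u) S ^ 2) := Finset.sum_nonneg fun e _ => by
    rw [← Ex_const (ι := EdgeIdx n) p (0 : ℝ)]
    exact Ex_mono h0 h1 fun S => sq_nonneg _
  calc _ ≤ p * ((n * n) * (32 * p * M * U) ^ 2) := mul_le_mul (by nlinarith) hb hnn h0
    _ = _ := by rw [hlam]; field_simp

end MainEstimates

section MeanPart

variable {n : ℕ}

/-- Limit variance in terms of the Poisson law. -/
def sig (lam : ℝ) (g : ℕ → ℝ) : ℝ :=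
  Po lam (fun k => g k ^ 2) - Po lam g ^ 2 + lam * Po lam (fun k => g (k + 1) - g k) ^ 2

lemma mean_term {p lam U M : ℝ} (h0 : 0 ≤ p) (h1 : p ≤ 1) (hn : 0 < n) (hlam : lam = n * p)
    {g u : ℕ → ℝ} (hg : ∀ k, |g k| ≤ M) (hu : ∀ k, |u k| ≤ U) (v : Fin n) (e : EdgeIdx n)
    (hv : e ∈ edgesAt n v) :
    |Ex p (fun S => u (dm e v S) * DW g e S) - (Po lam (fun k => u k * (g (k + 1) - g k)) +
      Po lam u * Po lam (fun k => g (k + 1) - g k))| ≤ 6 * p * kap lam * U * M := by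
  have hU : 0 ≤ U := (abs_nonneg _).trans (hu 0)
  have hM : 0 ≤ M := (abs_nonneg _).trans (hg 0)
  have hl : 0 ≤ lam := by rw [hlam]; positivity
  have hve := mem_edgesAt.1 hv
  let b : ℕ → ℝ := fun k => g (k + 1) - g k
  have hb : ∀ k, |b k| ≤ 2 * M := fun k => by
    have h1 := abs_sub (g (k + 1)) (g k)
    have h2 := hg (k + 1)
    have h3 := hg k
    simp only [b]
    linarith
  have hub : ∀ j k, |u j * b k| ≤ U * (2 * M) := fun j k => by
    rw [abs_mul]; exact mul_le_mul (hu _) (hb _) (abs_nonneg _) hU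
  obtain ⟨w, hw⟩ : ∃ w, (ends e).erase v = {w} := by
    rw [← Finset.card_eq_one, Finset.card_erase_of_mem (mem_ends.2 hve), card_ends]
  have hwm : w ∈ (ends e).erase v := by rw [hw]; simp
  have hwv : w ≠ v := Finset.ne_of_mem_erase hwm
  have hwe : w ∈ (e : Sym2 (Fin n)) := mem_ends.1 (Finset.mem_of_mem_erase hwm)
  have hDW : ∀ S, DW g e S = b (dm e v S) + b (dm e w S) := fun S => by
    unfold DW
    rw [← Finset.add_sum_erase _ _ (mem_ends.2 hve), hw, Finset.sum_singleton]
  have e1 : Ex p (fun S => u (dm e v S) * DW g e S) =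
      Ex p (fun S => u (dm e v S) * b (dm e v S)) + Ex p (fun S => u (dm e v S) * b (dm e w S)) := by
    rw [← Ex_add]
    congr 1; funext S; rw [hDW]; ring
  set q := (3 + 2 * lam) * (2 * Real.exp lam) with hq
  have hq0 : 0 ≤ q := by positivity
  have a1 : |Ex p (fun S => u (dm e v S) * b (dm e v S)) -
      Ex p (fun S => u (degree n S v) * b (degree n S v))| ≤ p * (2 * (U * (2 * M))) :=
    Ex_remove h0 h1 e (G := fun S => u (degree n S v) * b (degree n S v)) fun S => hub _ _
  have a2 := vertex_poisson h0 h1 hn hlam (f := fun k => u k * b k) (fun k => hub k k) v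
    (F := fun _ => 1) (B := 1) (fun S => by simp) e (fun e' _ _ S => by simp [Dd])
  simp only [mul_one, Ex_const] at a2
  have a3 : |Ex p (fun S => u (dm e v S) * b (dm e w S)) -
      Ex p (fun S => u (degree n S v) * b (degree n S w))| ≤ p * (2 * (U * (2 * M))) :=
    Ex_remove h0 h1 e (G := fun S => u (degree n S v) * b (degree n S w)) fun S => hub _ _
  have a4 := vertex_poisson h0 h1 hn hlam hu v
    (F := fun S => b (degree n S w)) (B := 2 * M) (fun S => hb _) e (fun e' he' hne S => by
      have : w ∉ (e' : Sym2 (Fin n)) := fun hw' => hne (edge_unique hwv hw' he' hwe hve)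
      simp only [Dd]
      rw [degree_update_notMem _ this, degree_update_notMem _ this, sub_self])
  have a5 := vertex_poisson h0 h1 hn hlam hb w
    (F := fun _ => 1) (B := 1) (fun S => by simp) e (fun e' _ _ S => by simp [Dd])
  simp only [mul_one, Ex_const] at a5
  have a6 : |Po lam u * Ex p (fun S => b (degree n S w)) - Po lam u * Po lam b| ≤
      U * (p * q * (2 * M)) := by
    rw [← mul_sub, abs_mul]
    exact mul_le_mul (abs_Po_le hl hu) a5 (abs_nonneg _) hU
  rw [e1]
  have hk : kap lam = q + 2 := rfl
  rw [hk]
  rw [abs_le] at *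
  have : 0 ≤ p * U * M := by positivity
  have : 0 ≤ p * U * M * q := by positivity
  constructor <;> linarith [a1.1, a1.2, a2.1, a2.2, a3.1, a3.2, a4.1, a4.2, a6.1, a6.2]

lemma mean_Tt {p lam U M : ℝ} (h0 : 0 ≤ p) (h1 : p ≤ 1) (hn : 0 < n) (hlam : lam = n * p)
    {g u : ℕ → ℝ} (hg : ∀ k, |g k| ≤ M) (hu : ∀ k, |u k| ≤ U)
    (heq : ∀ k : ℕ, lam * u k - k * u (k - 1) = g k - Po lam g) :
    |Ex p (Tt n p g u) + sig lam g| ≤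
      (6 * lam ^ 2 * kap lam * U * M + 4 * lam * (lam + 1) * U * M) / n := by
  have hU : 0 ≤ U := (abs_nonneg _).trans (hu 0)
  have hM : 0 ≤ M := (abs_nonneg _).trans (hg 0)
  have hl : 0 ≤ lam := by rw [hlam]; positivity
  have hn' : (0 : ℝ) < n := by positivity
  have hkap : 0 ≤ kap lam := by unfold kap; positivity
  have hb : ∀ k, |g (k + 1) - g k| ≤ 2 * M := fun k => by
    have h1 := abs_sub (g (k + 1)) (g k)
    have h2 := hg (k + 1)
    have h3 := hg k
    linarith
  have hub : ∀ k, |u k * (g (k + 1) - g k)| ≤ U * (2 * M) := fun k => by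
    rw [abs_mul]; exact mul_le_mul (hu _) (hb _) (abs_nonneg _) hU
  set A := Po lam (fun k => u k * (g (k + 1) - g k)) +
      Po lam u * Po lam (fun k => g (k + 1) - g k) with hA
  have hsig : sig lam g = - (lam * A) := by
    have i1 := stein_ident1 hl hg hu heq
    have i2 := stein_ident2 hl hg hu heq
    rw [hA, mul_add, i1, i2, sig]
    ring
  have hAb : |A| ≤ 4 * U * M := by
    refine (abs_add_le _ _).trans ?_
    have c1 := abs_Po_le hl hub
    have c2 : |Po lam u * Po lam (fun k => g (k + 1) - g k)| ≤ U * (2 * M) := by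
      rw [abs_mul]
      exact mul_le_mul (abs_Po_le hl hu) (abs_Po_le hl hb) (abs_nonneg _) hU
    linarith
  have e1 : Ex p (Tt n p g u) = (p * (1 - p) / n) *
      ∑ v, ∑ e ∈ edgesAt n v, Ex p (fun S => u (dm e v S) * DW g e S) := by
    unfold Tt
    rw [Ex_mul_left]
    simp only [Ex_sum]
  have e2 : (p * (1 - p) / n) * ∑ v : Fin n, ∑ e ∈ edgesAt n v, A =
      lam * (1 - p) * (1 - 1 / n) * A := by
    simp only [Finset.sum_const, card_edgesAt, Finset.card_univ, Fintype.card_fin, nsmul_eq_mul]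
    rw [Nat.cast_sub hn, hlam]
    push_cast
    field_simp
  have b1 : |Ex p (Tt n p g u) - lam * (1 - p) * (1 - 1 / n) * A| ≤
      6 * lam ^ 2 * kap lam * U * M / n := by
    rw [e1, ← e2, ← mul_sub, ← Finset.sum_sub_distrib]
    simp only [← Finset.sum_sub_distrib]
    have hs : |∑ v, ∑ e ∈ edgesAt n v, (Ex p (fun S => u (dm e v S) * DW g e S) - A)| ≤
        n * (n * (6 * p * kap lam * U * M)) := by
      calc _ ≤ ∑ v : Fin n, (n * (6 * p * kap lam * U * M) : ℝ) :=
            (Finset.abs_sum_le_sum_abs _ _).trans (Finset.sum_le_sum fun v _ => by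
              calc _ ≤ ∑ e ∈ edgesAt n v, (6 * p * kap lam * U * M) :=
                    (Finset.abs_sum_le_sum_abs _ _).trans (Finset.sum_le_sum fun e he =>
                      mean_term h0 h1 hn hlam hg hu v e he)
                _ ≤ _ := by
                  rw [Finset.sum_const, nsmul_eq_mul, card_edgesAt]
                  refine mul_le_mul_of_nonneg_right ?_ (by positivity)
                  exact_mod_cast Nat.sub_le _ _)
        _ = _ := by rw [Finset.sum_const, Finset.card_univ, Fintype.card_fin, nsmul_eq_mul]
    have hpp : 0 ≤ p * (1 - p) := mul_nonneg h0 (by linarith)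
    rw [abs_mul, abs_of_nonneg (by positivity)]
    calc _ ≤ (p / n) * (n * (n * (6 * p * kap lam * U * M))) := by
          refine mul_le_mul ?_ hs (abs_nonneg _) (by positivity)
          gcongr
          nlinarith
      _ = _ := by rw [hlam]; field_simp
  have b2 : |lam * (1 - p) * (1 - 1 / n) * A - lam * A| ≤
      4 * lam * (lam + 1) * U * M / n := by
    have hfac : lam * (1 - p) * (1 - 1 / n) * A - lam * A =
        - ((lam * ((lam + 1 - p) / n)) * A) := by
      have : p = lam / n := by rw [hlam]; field_simp
      rw [this]
      field_simp
      ring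
    rw [hfac, abs_neg, abs_mul]
    have h3 : 0 ≤ lam * ((lam + 1 - p) / n) := by
      refine mul_nonneg hl (div_nonneg ?_ hn'.le)
      linarith
    rw [abs_of_nonneg h3]
    calc _ ≤ (lam * ((lam + 1) / n)) * (4 * U * M) := by
          refine mul_le_mul ?_ hAb (abs_nonneg _) (by positivity)
          gcongr
          linarith
      _ = _ := by ring
  rw [hsig, add_div]
  have := abs_add_le (Ex p (Tt n p g u) - lam * (1 - p) * (1 - 1 / n) * A)
    (lam * (1 - p) * (1 - 1 / n) * A - lam * A)
  rw [sub_add_sub_cancel] at this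
  rw [← sub_eq_add_neg]
  linarith

/-- ODE comparison. -/
lemma ode_compare (φ φ' : ℝ → ℂ) (v ε : ℝ) (hv : 0 ≤ v) (h0 : φ 0 = 1)
    (hd : ∀ s, HasDerivAt φ (φ' s) s)
    (hb : ∀ s ∈ Set.Icc (0 : ℝ) 1, ‖φ' s + (s * v : ℝ) * φ s‖ ≤ ε) :
    ‖φ 1 - Complex.exp ((-(v / 2) : ℝ) : ℂ)‖ ≤ ε := by
  have hε : 0 ≤ ε := (norm_nonneg _).trans (hb 0 (by simp))
  let ψ : ℝ → ℂ := fun s => φ s * Complex.exp ((v / 2 * s ^ 2 : ℝ) : ℂ)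
  have hexp : ∀ s : ℝ, HasDerivAt (fun s : ℝ => Complex.exp ((v / 2 * s ^ 2 : ℝ) : ℂ))
      (Complex.exp ((v / 2 * s ^ 2 : ℝ) : ℂ) * ((s * v : ℝ) : ℂ)) s := by
    intro s
    have h1 : HasDerivAt (fun s : ℝ => v / 2 * s ^ 2) (s * v) s := by
      have := (hasDerivAt_pow 2 s).const_mul (v / 2)
      exact this.congr_deriv (by push_cast; ring)
    exact h1.ofReal_comp.cexp
  have hψ : ∀ s, HasDerivAt ψ ((φ' s + (s * v : ℝ) * φ s) *
      Complex.exp ((v / 2 * s ^ 2 : ℝ) : ℂ)) s := by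
    intro s
    have := (hd s).mul (hexp s)
    exact this.congr_deriv (by ring)
  have hbound : ∀ s ∈ Set.Ico (0 : ℝ) 1, ‖(φ' s + (s * v : ℝ) * φ s) *
      Complex.exp ((v / 2 * s ^ 2 : ℝ) : ℂ)‖ ≤ ε * Real.exp (v / 2) := by
    intro s hs
    rw [norm_mul, Complex.norm_exp_ofReal]
    refine mul_le_mul (hb s ⟨hs.1, hs.2.le⟩) ?_ (Real.exp_pos _).le hε
    refine Real.exp_le_exp.2 ?_
    have : s ^ 2 ≤ 1 := by nlinarith [hs.1, hs.2]
    nlinarith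
  have := norm_image_sub_le_of_norm_deriv_le_segment_01'
    (fun s _ => (hψ s).hasDerivWithinAt) hbound
  have e1 : φ 1 - Complex.exp ((-(v / 2) : ℝ) : ℂ) =
      (ψ 1 - ψ 0) * Complex.exp ((-(v / 2) : ℝ) : ℂ) := by
    simp only [ψ, h0]
    rw [sub_mul, mul_assoc, ← Complex.exp_add]
    have : (((v / 2 * 1 ^ 2 : ℝ) : ℂ) + ((-(v / 2) : ℝ) : ℂ)) = 0 := by push_cast; ring
    rw [this]
    simp
  rw [e1, norm_mul, Complex.norm_exp_ofReal]
  calc _ ≤ ε * Real.exp (v / 2) * Real.exp (-(v / 2)) :=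
        mul_le_mul_of_nonneg_right this (Real.exp_pos _).le
    _ = ε := by rw [mul_assoc, ← Real.exp_add, add_neg_cancel, Real.exp_zero, mul_one]

/-- Quantitative CLT for the characteristic function at 1. -/
lemma charfun_bound {p lam U M v : ℝ} (hv : 0 ≤ v) (h0 : 0 ≤ p) (h1 : p ≤ 1) (hn : 0 < n)
    (hlam : lam = n * p)
    {g u : ℕ → ℝ} (hg : ∀ k, |g k| ≤ M) (hu : ∀ k, |u k| ≤ U)
    (heq : ∀ k : ℕ, lam * u k - k * u (k - 1) = g k - Po lam g) :
    ‖Ex p (Fx n lam g (Real.sqrt n)⁻¹) - Complex.exp ((-(v / 2) : ℝ) : ℂ)‖ ≤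
      (lam * (1 + 2 * lam) * U + lam * (U * (48 * M ^ 2))) / Real.sqrt n +
      ((6 * lam ^ 2 * kap lam * U * M + 4 * lam * (lam + 1) * U * M) / n + |sig lam g - v|
        + Real.sqrt (lam ^ 3 * (32 * M * U) ^ 2 / n)) := by
  have hU : 0 ≤ U := (abs_nonneg _).trans (hu 0)
  have hM : 0 ≤ M := (abs_nonneg _).trans (hg 0)
  have hl : 0 ≤ lam := by rw [hlam]; positivity
  have hn' : (0 : ℝ) < n := by positivity
  set q := Real.sqrt n with hq
  have hq0 : 0 < q := Real.sqrt_pos.2 hn'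
  have hq2 : q * q = n := Real.mul_self_sqrt hn'.le
  let φ : ℝ → ℂ := fun s => Ex p (Fx n lam g (s * q⁻¹))
  let φ' : ℝ → ℂ := fun s => Ex p (fun S => (Complex.I * (q⁻¹ : ℝ)) *
    (Wt n lam g S • Fx n lam g (s * q⁻¹) S))
  have hd : ∀ s, HasDerivAt φ (φ' s) s := by
    intro s
    simp only [φ, φ', Ex]
    refine HasDerivAt.fun_sum fun S _ => HasDerivAt.const_smul _ ?_
    unfold Fx
    have h1 : HasDerivAt (fun s : ℝ => s * q⁻¹ * Wt n lam g S) (q⁻¹ * Wt n lam g S) s := by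
      have := ((hasDerivAt_id s).mul_const q⁻¹).mul_const (Wt n lam g S)
      simpa using this
    have h2 := (h1.ofReal_comp.const_mul Complex.I).cexp
    exact h2.congr_deriv (by rw [Complex.real_smul]; push_cast; ring)
  have hφ0 : φ 0 = 1 := by
    have e : Fx n lam g (0 * q⁻¹) = fun _ => 1 := by funext S; simp [Fx]
    simp only [φ]
    rw [e]
    exact Ex_const p 1
  have hmain := ode_compare φ φ' v ((lam * (1 + 2 * lam) * U +
      lam * (U * (48 * M ^ 2))) / q +
      ((6 * lam ^ 2 * kap lam * U * M + 4 * lam * (lam + 1) * U * M) / n + |sig lam g - v|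
        + Real.sqrt (lam ^ 3 * (32 * M * U) ^ 2 / n))) hv hφ0 hd ?_
  · simpa only [φ, one_mul] using hmain
  intro s hs
  set F := Fx n lam g (s * q⁻¹) with hF
  have hst := stein_W (r := s * q⁻¹) h0 h1 hn hlam hg hu heq
  rw [← hF] at hst
  have hT : ‖Ex p (fun S => (Tt n p g u S + v) • F S)‖ ≤
      (6 * lam ^ 2 * kap lam * U * M + 4 * lam * (lam + 1) * U * M) / n + |sig lam g - v|
        + Real.sqrt (lam ^ 3 * (32 * M * U) ^ 2 / n) := by
    have h2 := Ex_abs_sub_le h0 h1 (Tt n p g u) (-v) _ (var_Tt h0 h1 hn hlam hg hu)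
    have h3 := mean_Tt h0 h1 hn hlam hg hu heq
    refine (norm_Ex_le h0 h1 _).trans ?_
    have h4 : (fun S => ‖(Tt n p g u S + v) • F S‖) = fun S => |Tt n p g u S - -v| := by
      funext S
      rw [norm_smul, hF, norm_Fx, mul_one, sub_neg_eq_add, Real.norm_eq_abs]
    rw [h4]
    refine h2.trans ?_
    have h5 := abs_sub (Ex p (Tt n p g u) + sig lam g) (sig lam g - v)
    rw [show Ex p (Tt n p g u) + sig lam g - (sig lam g - v) = Ex p (Tt n p g u) - -v by ring] at h5
    linarith
  have key : φ' s + (s * v : ℝ) * φ s =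
      (Complex.I * (q⁻¹ : ℝ)) * (Ex p (fun S => Wt n lam g S • F S) +
        (Complex.I * (s * q⁻¹ : ℝ) * n) * Ex p (fun S => Tt n p g u S • F S)) +
      s * Ex p (fun S => (Tt n p g u S + v) • F S) := by
    simp only [φ', φ, ← hF]
    rw [Ex_cmul_left]
    simp only [add_smul]
    rw [Ex_add, Ex_smul p v F, Complex.real_smul]
    have hq2' : (n : ℂ) = (q : ℂ) * q := by exact_mod_cast hq2.symm
    rw [hq2']
    have hqc : (q : ℂ) ≠ 0 := by exact_mod_cast hq0.ne'
    push_cast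
    field_simp
    linear_combination (-((q : ℂ) * s * Ex p (fun S => Tt n p g u S • F S))) * Complex.I_sq
  rw [key]
  have n1 : ‖(Complex.I * (q⁻¹ : ℝ)) * (Ex p (fun S => Wt n lam g S • F S) +
        (Complex.I * (s * q⁻¹ : ℝ) * n) * Ex p (fun S => Tt n p g u S • F S))‖ ≤
      (lam * (1 + 2 * lam) * U + lam * (U * (48 * M ^ 2))) / q := by
    rw [norm_mul, norm_mul, Complex.norm_I, one_mul, Complex.norm_real,
      Real.norm_of_nonneg (by positivity), div_eq_inv_mul]
    refine mul_le_mul_of_nonneg_left (hst.trans ?_) (by positivity)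
    have : lam * n * (U * (3 * (4 * M * (s * q⁻¹)) ^ 2)) = lam * (U * (48 * M ^ 2)) * s ^ 2 := by
      rw [← hq2]
      field_simp
      ring
    rw [this]
    have hs2 : s ^ 2 ≤ 1 := by nlinarith [hs.1, hs.2]
    have : 0 ≤ lam * (U * (48 * M ^ 2)) := by positivity
    nlinarith
  have n2 : ‖(s : ℂ) * Ex p (fun S => (Tt n p g u S + v) • F S)‖ ≤
      (6 * lam ^ 2 * kap lam * U * M + 4 * lam * (lam + 1) * U * M) / n + |sig lam g - v|
        + Real.sqrt (lam ^ 3 * (32 * M * U) ^ 2 / n) := by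
    rw [norm_mul, Complex.norm_real, Real.norm_of_nonneg hs.1]
    refine le_trans ?_ hT
    have := norm_nonneg (Ex p (fun S => (Tt n p g u S + v) • F S))
    nlinarith [hs.2]
  exact norm_add_le_of_le n1 n2

end MeanPart

section Final

/-- Extension of a vector to a finitely supported function. -/
def ext0 (K : ℕ) (t : Fin (K + 1) → ℝ) (j : ℕ) : ℝ :=
  if h : j < K + 1 then t ⟨j, h⟩ else 0

/-- The limiting covariance matrix. -/
def covM (lam : ℝ) (K : ℕ) : Matrix (Fin (K + 1)) (Fin (K + 1)) ℝ :=
  fun j k => poissonProb lam j * poissonProb lam k *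
            (((j : ℝ) - lam) * ((k : ℝ) - lam) / lam - 1) +
          poissonProb lam k * (if j = k then 1 else 0)

lemma ext0_coe (K : ℕ) (t : Fin (K + 1) → ℝ) (k : Fin (K + 1)) : ext0 K t k = t k := by
  unfold ext0
  rw [dif_pos k.2]

lemma ext0_bound (K : ℕ) (t : Fin (K + 1) → ℝ) (j : ℕ) : |ext0 K t j| ≤ ∑ k, |t k| := by
  unfold ext0
  split_ifs with h
  · exact Finset.single_le_sum (f := fun k => |t k|) (fun k _ => abs_nonneg _) (Finset.mem_univ _)
  · simp only [abs_zero]; positivity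

lemma Po_fin (lam : ℝ) (K : ℕ) (f : ℕ → ℝ) (hf : ∀ j, K + 1 ≤ j → f j = 0) :
    Po lam f = ∑ k : Fin (K + 1), poissonProb lam k * f k := by
  unfold Po
  rw [tsum_eq_sum (s := Finset.range (K + 1))]
  · exact Finset.sum_range (fun k => poissonProb lam k * f k)
  · intro b hb
    rw [hf b (by simpa using hb), mul_zero]

lemma ext0_zero (K : ℕ) (t : Fin (K + 1) → ℝ) (j : ℕ) (h : K + 1 ≤ j) : ext0 K t j = 0 := by
  simp [ext0, Nat.not_lt.2 h]

lemma sig_ext0 {lam : ℝ} (hl : 0 < lam) (K : ℕ) (t : Fin (K + 1) → ℝ) :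
    sig lam (ext0 K t) = ∑ k : Fin (K + 1), poissonProb lam k * t k ^ 2
      - (∑ k : Fin (K + 1), poissonProb lam k * t k) ^ 2
      + (∑ k : Fin (K + 1), poissonProb lam k * (((k : ℝ) - lam) * t k)) ^ 2 / lam := by
  have h := Po_diff hl.le (ext0_bound K t)
  have e1 : Po lam (fun k => ((k : ℝ) - lam) * ext0 K t k) =
      ∑ k : Fin (K + 1), poissonProb lam k * (((k : ℝ) - lam) * t k) := by
    rw [Po_fin lam K _ (fun j hj => by rw [ext0_zero K t j hj, mul_zero])]
    simp only [ext0_coe]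
  have e2 : Po lam (ext0 K t) = ∑ k : Fin (K + 1), poissonProb lam k * t k := by
    rw [Po_fin lam K _ (ext0_zero K t)]
    simp only [ext0_coe]
  have e3 : Po lam (fun k => ext0 K t k ^ 2) = ∑ k : Fin (K + 1), poissonProb lam k * t k ^ 2 := by
    rw [Po_fin lam K _ (fun j hj => by rw [ext0_zero K t j hj]; norm_num)]
    simp only [ext0_coe]
  rw [e1] at h
  rw [sig, e2, e3, ← h]
  field_simp

lemma quad_covM (lam : ℝ) (K : ℕ) (t : Fin (K + 1) → ℝ) :
    t ⬝ᵥ (covM lam K).mulVec t = ∑ k : Fin (K + 1), poissonProb lam k * t k ^ 2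
      - (∑ k : Fin (K + 1), poissonProb lam k * t k) ^ 2
      + (∑ k : Fin (K + 1), poissonProb lam k * (((k : ℝ) - lam) * t k)) ^ 2 / lam := by
  have h1 : ∀ j : Fin (K + 1), (covM lam K).mulVec t j =
      poissonProb lam j * t j - poissonProb lam j * ∑ k : Fin (K + 1), poissonProb lam k * t k
      + poissonProb lam j * ((j : ℝ) - lam) *
        (∑ k : Fin (K + 1), poissonProb lam k * (((k : ℝ) - lam) * t k)) / lam := by
    intro j
    have : poissonProb lam j * t j =
        ∑ k : Fin (K + 1), poissonProb lam k * (if j = k then 1 else 0) * t k := by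
      simp
    rw [this]
    simp only [Matrix.mulVec, dotProduct, covM]
    rw [Finset.mul_sum, Finset.mul_sum, Finset.sum_div, ← Finset.sum_sub_distrib,
      ← Finset.sum_add_distrib]
    refine Finset.sum_congr rfl fun k _ => ?_
    ring
  simp only [dotProduct, h1]
  rw [sq, sq, Finset.sum_mul, Finset.sum_mul, Finset.sum_div, ← Finset.sum_sub_distrib,
      ← Finset.sum_add_distrib]
  refine Finset.sum_congr rfl fun k _ => ?_
  ring

lemma sum_pp_le {lam : ℝ} (hl : 0 ≤ lam) (K : ℕ) :
    ∑ k : Fin (K + 1), poissonProb lam k ≤ 1 := by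
  rw [← Finset.sum_range (fun k => poissonProb lam k)]
  exact sum_le_hasSum _ (fun k _ => pp_nonneg hl k) (hasSum_pp lam)

lemma quad_nonneg {lam : ℝ} (hl : 0 < lam) (K : ℕ) (t : Fin (K + 1) → ℝ) :
    0 ≤ t ⬝ᵥ (covM lam K).mulVec t := by
  rw [quad_covM]
  have h1 : (∑ k : Fin (K + 1), poissonProb lam k * t k) ^ 2 ≤
      (∑ k : Fin (K + 1), poissonProb lam k) *
        ∑ k : Fin (K + 1), poissonProb lam k * t k ^ 2 := by
    refine Finset.sum_sq_le_sum_mul_sum_of_sq_le_mul _ (fun k _ => pp_nonneg hl.le k)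
      (fun k _ => mul_nonneg (pp_nonneg hl.le k) (sq_nonneg _)) (fun k _ => le_of_eq (by ring))
  have h2 : 0 ≤ ∑ k : Fin (K + 1), poissonProb lam k * t k ^ 2 :=
    Finset.sum_nonneg fun k _ => mul_nonneg (pp_nonneg hl.le k) (sq_nonneg _)
  have h3 := sum_pp_le hl.le K
  have h4 : 0 ≤ (∑ k : Fin (K + 1), poissonProb lam k * (((k : ℝ) - lam) * t k)) ^ 2 / lam := by
    positivity
  nlinarith

lemma covM_posSemidef {lam : ℝ} (hl : 0 < lam) (K : ℕ) : (covM lam K).PosSemidef := by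
  refine Matrix.PosSemidef.of_dotProduct_mulVec_nonneg ?_ ?_
  · ext j k
    simp only [Matrix.conjTranspose_apply, covM, star_trivial]
    by_cases h : j = k
    · subst h; ring
    · rw [if_neg h, if_neg (Ne.symm h)]; ring
  · intro x
    rw [star_trivial]
    exact quad_nonneg hl K x

lemma tendsto_sig {lamn : ℕ → ℝ} {lam : ℝ} (hl : 0 < lam) (h : Tendsto lamn atTop (𝓝 lam))
    (K : ℕ) (t : Fin (K + 1) → ℝ) :
    Tendsto (fun n => sig (lamn n) (ext0 K t)) atTop (𝓝 (t ⬝ᵥ (covM lam K).mulVec t)) := by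
  have hc : ContinuousAt (fun lam => t ⬝ᵥ (covM lam K).mulVec t) lam := by
    simp only [quad_covM, poissonProb]
    have : lam ≠ 0 := hl.ne'
    fun_prop (disch := assumption)
  have := hc.tendsto.comp h
  refine this.congr' ?_
  filter_upwards [h.eventually (lt_mem_nhds hl)] with n hn
  rw [sig_ext0 hn, Function.comp, quad_covM]

lemma tendsto_Ex_Fx {lamn : ℕ → ℝ} {lam : ℝ} (hl : 0 < lam) (h : Tendsto lamn atTop (𝓝 lam))
    (K : ℕ) (t : Fin (K + 1) → ℝ) :
    Tendsto (fun n : ℕ => Ex (lamn n / n) (Fx n (lamn n) (ext0 K t) (Real.sqrt n)⁻¹)) atTop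
      (𝓝 (Complex.exp ((-((t ⬝ᵥ (covM lam K).mulVec t) / 2) : ℝ) : ℂ))) := by
  rw [tendsto_iff_norm_sub_tendsto_zero]
  set v := t ⬝ᵥ (covM lam K).mulVec t with hv
  set M := ∑ k, |t k| with hM
  have hM0 : 0 ≤ M := Finset.sum_nonneg fun _ _ => abs_nonneg _
  have hsq : Tendsto (fun n : ℕ => (Real.sqrt n)) atTop atTop :=
    Real.tendsto_sqrt_atTop.comp tendsto_natCast_atTop_atTop
  have hnat : Tendsto (fun n : ℕ => (n : ℝ)) atTop atTop := tendsto_natCast_atTop_atTop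
  let B : ℕ → ℝ := fun n => (lamn n * (1 + 2 * lamn n) * (2 * M * Real.exp (lamn n)) +
    lamn n * ((2 * M * Real.exp (lamn n)) * (48 * M ^ 2))) / Real.sqrt n +
      ((6 * lamn n ^ 2 * kap (lamn n) * (2 * M * Real.exp (lamn n)) * M
        + 4 * lamn n * (lamn n + 1) * (2 * M * Real.exp (lamn n)) * M) / n
        + |sig (lamn n) (ext0 K t) - v|
        + Real.sqrt (lamn n ^ 3 * (32 * M * (2 * M * Real.exp (lamn n))) ^ 2 / n))
  have hB : Tendsto B atTop (𝓝 0) := by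
    have a1 : Tendsto (fun n => lamn n * (1 + 2 * lamn n) * (2 * M * Real.exp (lamn n)) +
      lamn n * ((2 * M * Real.exp (lamn n)) * (48 * M ^ 2))) atTop
        (𝓝 (lam * (1 + 2 * lam) * (2 * M * Real.exp lam) +
          lam * ((2 * M * Real.exp lam) * (48 * M ^ 2)))) :=
      Tendsto.comp (g := fun x => x * (1 + 2 * x) * (2 * M * Real.exp x) +
        x * ((2 * M * Real.exp x) * (48 * M ^ 2))) (Continuous.tendsto (by fun_prop) lam) h
    have a2 : Tendsto (fun n => 6 * lamn n ^ 2 * kap (lamn n) * (2 * M * Real.exp (lamn n)) * M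
        + 4 * lamn n * (lamn n + 1) * (2 * M * Real.exp (lamn n)) * M) atTop
        (𝓝 (6 * lam ^ 2 * kap lam * (2 * M * Real.exp lam) * M
        + 4 * lam * (lam + 1) * (2 * M * Real.exp lam) * M)) :=
      Tendsto.comp (g := fun x => 6 * x ^ 2 * kap x * (2 * M * Real.exp x) * M
        + 4 * x * (x + 1) * (2 * M * Real.exp x) * M)
        (Continuous.tendsto (by unfold kap; fun_prop) lam) h
    have a3 : Tendsto (fun n => lamn n ^ 3 * (32 * M * (2 * M * Real.exp (lamn n))) ^ 2) atTop
        (𝓝 (lam ^ 3 * (32 * M * (2 * M * Real.exp lam)) ^ 2)) :=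
      Tendsto.comp (g := fun x => x ^ 3 * (32 * M * (2 * M * Real.exp x)) ^ 2)
        (Continuous.tendsto (by fun_prop) lam) h
    have a4 : Tendsto (fun n => |sig (lamn n) (ext0 K t) - v|) atTop (𝓝 0) := by
      have := ((tendsto_sig hl h K t).sub_const v).abs
      simpa [hv] using this
    have b1 := a1.div_atTop hsq
    have b2 := a2.div_atTop hnat
    have b3 := (Real.continuous_sqrt.tendsto 0).comp (a3.div_atTop hnat)
    rw [Real.sqrt_zero] at b3
    have := b1.add ((b2.add a4).add b3)
    rw [add_zero, add_zero, add_zero] at this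
    exact this
  refine squeeze_zero' (Eventually.of_forall fun n => norm_nonneg _) ?_ hB
  have hp : Tendsto (fun n : ℕ => lamn n / n) atTop (𝓝 0) := h.div_atTop hnat
  filter_upwards [h.eventually (lt_mem_nhds hl), hp.eventually (gt_mem_nhds one_pos),
    eventually_gt_atTop 0] with n h1 h2 h3
  obtain ⟨u, hu, heq⟩ := stein_solution h1.le (ext0_bound K t)
  have hn : (n : ℝ) ≠ 0 := by positivity
  exact charfun_bound (quad_nonneg hl K t) (by positivity) h2.le h3
    (by field_simp) (ext0_bound K t) hu heq

lemma gnp_prob {n : ℕ} {p : ℝ} (h0 : 0 ≤ p) (h1 : p ≤ 1) :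
    IsProbabilityMeasure (gnpMeasure n p) := by
  constructor
  have e : ∀ S : EdgeIdx n → Bool, (∏ e : EdgeIdx n, if S e then ENNReal.ofReal p
      else ENNReal.ofReal (1 - p)) = ENNReal.ofReal (wt p S) := by
    intro S
    unfold wt
    rw [ENNReal.ofReal_prod_of_nonneg]
    · refine Finset.prod_congr rfl fun e _ => ?_
      split_ifs <;> rfl
    · intro e _
      split_ifs <;> linarith
  unfold gnpMeasure
  simp only [e]
  rw [Measure.finsetSum_apply]
  simp only [Measure.smul_apply, measure_univ, smul_eq_mul, mul_one]
  rw [← ENNReal.ofReal_sum_of_nonneg (fun S _ => wt_nonneg h0 h1 S), sum_wt, ENNReal.ofReal_one]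

lemma integral_gnp {n : ℕ} {p : ℝ} (h0 : 0 ≤ p) (h1 : p ≤ 1) (F : (EdgeIdx n → Bool) → ℂ) :
    ∫ S, F S ∂(gnpMeasure n p) = Ex p F := by
  have e : ∀ S : EdgeIdx n → Bool, (∏ e : EdgeIdx n, if S e then ENNReal.ofReal p
      else ENNReal.ofReal (1 - p)) = ENNReal.ofReal (wt p S) := by
    intro S
    unfold wt
    rw [ENNReal.ofReal_prod_of_nonneg]
    · refine Finset.prod_congr rfl fun e _ => ?_
      split_ifs <;> rfl
    · intro e _
      split_ifs <;> linarith
  unfold gnpMeasure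
  simp only [e]
  rw [integral_finsetSum_measure]
  · unfold Ex
    refine Finset.sum_congr rfl fun S _ => ?_
    rw [integral_smul_measure, integral_dirac, ENNReal.toReal_ofReal (wt_nonneg h0 h1 S)]
  · intro S _
    exact (integrable_dirac (by simp)).smul_measure ENNReal.ofReal_ne_top

lemma Wt_ext0 (n : ℕ) (lam : ℝ) (K : ℕ) (t : Fin (K + 1) → ℝ) (S : EdgeIdx n → Bool) :
    ∑ k : Fin (K + 1), ((Real.sqrt n)⁻¹ * ((degCount n k S : ℝ) - n * poissonProb lam k)) * t k
      = (Real.sqrt n)⁻¹ * Wt n lam (ext0 K t) S := by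
  have e2 : Po lam (ext0 K t) = ∑ k : Fin (K + 1), poissonProb lam k * t k := by
    rw [Po_fin lam K _ (ext0_zero K t)]
    simp only [ext0_coe]
  have e3 : ∑ v, ext0 K t (degree n S v) = ∑ k : Fin (K + 1), (degCount n k S : ℝ) * t k := by
    have : ∀ j : ℕ, ext0 K t j = ∑ k : Fin (K + 1), (if j = k then 1 else 0) * t k := by
      intro j
      by_cases h : j < K + 1
      · rw [Finset.sum_eq_single (⟨j, h⟩ : Fin (K + 1))]
        · simp [ext0, h]
        · intro b _ hb
          rw [if_neg, zero_mul]
          rintro rfl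
          exact hb rfl
        · simp
      · rw [ext0_zero K t j (by omega), Finset.sum_eq_zero]
        intro k _
        rw [if_neg (by have := k.2; omega), zero_mul]
    simp only [this]
    rw [Finset.sum_comm]
    refine Finset.sum_congr rfl fun k _ => ?_
    rw [← Finset.sum_mul]
    congr 1
    simp [degCount]
  unfold Wt
  rw [Finset.sum_sub_distrib, e2, e3, Finset.sum_const, Finset.card_univ, Fintype.card_fin,
    nsmul_eq_mul, Finset.mul_sum, ← Finset.sum_sub_distrib, Finset.mul_sum]
  refine Finset.sum_congr rfl fun k _ => ?_
  ring

/-- The normalised vector of degree counts. -/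
def Xv (n K : ℕ) (lam : ℝ) (S : EdgeIdx n → Bool) : Fin (K + 1) → ℝ :=
  fun k => (Real.sqrt n)⁻¹ * ((degCount n k S : ℝ) - n * poissonProb lam k)

lemma charFun_gnp {n : ℕ} {p : ℝ} (h0 : 0 ≤ p) (h1 : p ≤ 1) (K : ℕ) (lam : ℝ)
    (t : EuclideanSpace ℝ (Fin (K + 1))) :
    charFun ((gnpMeasure n p).map (fun S => WithLp.toLp 2 (Xv n K lam S))) t =
      Ex p (Fx n lam (ext0 K t.ofLp) (Real.sqrt n)⁻¹) := by
  rw [charFun_apply, integral_map (by fun_prop) (by fun_prop), integral_gnp h0 h1]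
  congr 1
  funext S
  unfold Fx
  rw [← Wt_ext0, mul_comm Complex.I]
  congr 3
  simp [PiLp.inner_apply, Xv, mul_comm]

end Final
/-- Theorem 4.1(i): joint asymptotic normality of the numbers of vertices of degree `k`,
`0 ≤ k ≤ K`, in `G(n, p)` with `p = λₙ/n`, `λₙ → λ > 0`. -/
theorem gnp_degree_counts_joint_clt
    (lamn : ℕ → ℝ) (lam : ℝ) (hlam : 0 < lam)
    (hconv : Tendsto lamn atTop (𝓝 lam)) (K : ℕ) :
    ∃ ν : Measure (Fin (K + 1) → ℝ),
      IsProbabilityMeasure ν ∧ IsGaussianMeasure ν ∧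
      (∀ k, (∫ x, x k ∂ν) = 0) ∧
      (∀ j k : Fin (K + 1), covFn ν (fun x => x j) (fun x => x k) =
        poissonProb lam j * poissonProb lam k *
            (((j : ℝ) - lam) * ((k : ℝ) - lam) / lam - 1) +
          poissonProb lam k * (if j = k then 1 else 0)) ∧
      TendstoInDistribution
        (fun n => (gnpMeasure n (lamn n / n)).map
          (fun S => fun k : Fin (K + 1) => (Real.sqrt n)⁻¹ *
            ((degCount n k S : ℝ) - n * poissonProb (lamn n) k)))
        ν := by
  set S := covM lam K with hS
  have hpsd : S.PosSemidef := covM_posSemidef hlam K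
  set γ : Measure (EuclideanSpace ℝ (Fin (K + 1))) := multivariateGaussian 0 S with hγ
  have hmeas : Measurable (fun x : EuclideanSpace ℝ (Fin (K + 1)) => x.ofLp) := by fun_prop
  have hL2 : ∀ k : Fin (K + 1), MemLp (fun x : EuclideanSpace ℝ (Fin (K + 1)) => x k) 2 γ := by
    intro k
    exact ((EuclideanSpace.proj (𝕜 := ℝ) k).comp_memLp' (IsGaussian.memLp_two_id (μ := γ)))
  have hint0 : ∀ k : Fin (K + 1), ∫ x, x k ∂γ = 0 := by
    intro k
    have h1 := (EuclideanSpace.proj k : EuclideanSpace ℝ (Fin (K + 1)) →L[ℝ] ℝ).integral_comp_comm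
      (IsGaussian.integrable_id (μ := γ))
    simp only [id, hγ, integral_id_multivariateGaussian, map_zero] at h1
    exact h1
  refine ⟨γ.map (fun x => x.ofLp), Measure.isProbabilityMeasure_map hmeas.aemeasurable, ?_, ?_,
    ?_, ?_⟩
  · intro L
    rw [Measure.map_map L.continuous.measurable hmeas]
    exact ⟨_, _, IsGaussian.map_eq_gaussianReal (μ := γ)
        (L.comp (EuclideanSpace.equiv (Fin (K + 1)) ℝ).toContinuousLinearMap)⟩
  · intro k
    rw [integral_map hmeas.aemeasurable (continuous_apply k).aestronglyMeasurable]
    exact hint0 k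
  · intro j k
    simp only [covFn]
    rw [integral_map hmeas.aemeasurable
        (((continuous_apply j).fun_mul (continuous_apply k)).aestronglyMeasurable),
      integral_map hmeas.aemeasurable (continuous_apply j).aestronglyMeasurable,
      integral_map hmeas.aemeasurable (continuous_apply k).aestronglyMeasurable]
    have h1 := covariance_eval_multivariateGaussian (μ := 0) hpsd j k
    rw [covariance_eq_sub (hL2 j) (hL2 k)] at h1
    exact h1
  · have hnat : Tendsto (fun n : ℕ => (n : ℝ)) atTop atTop := tendsto_natCast_atTop_atTop
    have hp : Tendsto (fun n : ℕ => lamn n / n) atTop (𝓝 0) := hconv.div_atTop hnat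
    have hgood : ∀ᶠ n : ℕ in atTop, 0 ≤ lamn n / n ∧ lamn n / n ≤ 1 := by
      filter_upwards [hconv.eventually (lt_mem_nhds hlam), hp.eventually (gt_mem_nhds one_pos)]
        with n h1 h2
      exact ⟨by positivity, h2.le⟩
    have hex : ∀ n : ℕ, ∃ P : ProbabilityMeasure (EuclideanSpace ℝ (Fin (K + 1))),
        0 ≤ lamn n / n ∧ lamn n / n ≤ 1 → (P : Measure (EuclideanSpace ℝ (Fin (K + 1)))) =
        (gnpMeasure n (lamn n / n)).map (fun S => WithLp.toLp 2 (Xv n K (lamn n) S)) := by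
      intro n
      by_cases h : 0 ≤ lamn n / n ∧ lamn n / n ≤ 1
      · have := gnp_prob (n := n) h.1 h.2
        exact ⟨⟨(gnpMeasure n (lamn n / n)).map (fun S => WithLp.toLp 2 (Xv n K (lamn n) S)),
          Measure.isProbabilityMeasure_map (by fun_prop)⟩, fun _ => rfl⟩
      · exact ⟨⟨Measure.dirac 0, inferInstance⟩, fun h' => absurd h' h⟩
    choose pm hpm using hex
    have hlim : Tendsto pm atTop (𝓝 ⟨γ, inferInstance⟩) := by
      refine ProbabilityMeasure.tendsto_of_tendsto_charFun fun t => ?_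
      have e : charFun γ t = Complex.exp ((-((t.ofLp ⬝ᵥ S.mulVec t.ofLp) / 2) : ℝ) : ℂ) := by
        rw [hγ, charFun_multivariateGaussian hpsd]
        congr 1
        simp
      rw [ProbabilityMeasure.coe_mk, e]
      refine (tendsto_Ex_Fx hlam hconv K t.ofLp).congr' ?_
      filter_upwards [hgood] with n hn
      rw [hpm n hn, charFun_gnp hn.1 hn.2]
    intro f
    have h1 := (ProbabilityMeasure.tendsto_iff_forall_integral_tendsto.1 hlim)
      (f.compContinuous ⟨fun x : EuclideanSpace ℝ (Fin (K + 1)) => x.ofLp, by fun_prop⟩)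
    rw [integral_map hmeas.aemeasurable f.continuous.aestronglyMeasurable]
    refine h1.congr' ?_
    filter_upwards [hgood] with n hn
    rw [hpm n hn, integral_map (by fun_prop) (by fun_prop),
      integral_map (by fun_prop) f.continuous.aestronglyMeasurable]
    rfl
end
end
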